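/- arXiv:2111.13399 — 2 statements merged into one kernel-verified Lean document; each statement's English description precedes it below -/
import Mathlib

section
/- Let p ≥ q ≥ 1 and n = p + q. For x = (x_1,…,x_q) ∈ ℝ^q write x̃ = (x_1,…,x_q,0,…,0,−x_q,…,−x_1) ∈ ℝ^n (with p − q zeros in the middle). Then for any (x,y,z) ∈ (ℝ^q_{++})^3, the triple (x,y,z) belongs to Singular(p,q) if and only if (x̃, ỹ, z̃) belongs to Horn(n). -/
open Matrix

/-- The eigenvalues of a Hermitian matrix, listed in decreasing order. -/
noncomputable def eigsDesc {n : ℕ} {A : Matrix (Fin n) (Fin n) ℂ} (hA : A.IsHermitian) :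
    Fin n → ℝ :=
  fun i => hA.eigenvalues (Tuple.sort hA.eigenvalues i.rev)

/-- The singular values of a complex `p × q` matrix, listed in decreasing order:
the square roots of the eigenvalues of the Hermitian matrix `Aᴴ * A`. -/
noncomputable def singularValues {p q : ℕ} (A : Matrix (Fin p) (Fin q) ℂ) : Fin q → ℝ :=
  fun i => Real.sqrt (eigsDesc (Matrix.isHermitian_conjTranspose_mul_self A) i)

/-- `sval A k` is the `k`-th singular value `τ_k(A)` of `A`, with 1-based indexing
(junk value `0` out of range). -/
noncomputable def sval {p q : ℕ} (A : Matrix (Fin p) (Fin q) ℂ) (k : ℕ) : ℝ :=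
  if h : k - 1 < q then singularValues A ⟨k - 1, h⟩ else 0

/-- `Horn n` is the set of triples `(s(A), s(B), s(C))` of decreasing eigenvalue vectors of
Hermitian `n × n` matrices `A`, `B`, `C` with `A + B + C = 0`. -/
def Horn (n : ℕ) : Set ((Fin n → ℝ) × (Fin n → ℝ) × (Fin n → ℝ)) :=
  {t | ∃ (A B C : Matrix (Fin n) (Fin n) ℂ) (hA : A.IsHermitian) (hB : B.IsHermitian)
      (hC : C.IsHermitian), A + B + C = 0 ∧
      eigsDesc hA = t.1 ∧ eigsDesc hB = t.2.1 ∧ eigsDesc hC = t.2.2}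

/-- `SingularCone p q` is the set of triples `(τ(A), τ(B), τ(C))` of singular value vectors
of complex `p × q` matrices `A`, `B`, `C` with `A + B + C = 0`. -/
def SingularCone (p q : ℕ) : Set ((Fin q → ℝ) × (Fin q → ℝ) × (Fin q → ℝ)) :=
  {t | ∃ A B C : Matrix (Fin p) (Fin q) ℂ, A + B + C = 0 ∧
      singularValues A = t.1 ∧ singularValues B = t.2.1 ∧ singularValues C = t.2.2}

/-- `x ∈ ℝ^q_{++}` : the coordinates of `x` are weakly decreasing and nonnegative. -/
def DecrNonneg {q : ℕ} (x : Fin q → ℝ) : Prop :=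
  (∀ i j : Fin q, i ≤ j → x j ≤ x i) ∧ ∀ i, 0 ≤ x i

/-- `x̃ = (x_1, …, x_q, 0, …, 0, −x_q, …, −x_1) ∈ ℝ^{p+q}`, with `p − q` zeros in
the middle. -/
def tildeVec (p q : ℕ) (x : Fin q → ℝ) : Fin (p + q) → ℝ := fun k =>
  if h1 : k.val < q then x ⟨k.val, h1⟩
  else if h2 : k.val < p then 0
  else -x ⟨p + q - 1 - k.val, by have hk := k.isLt; omega⟩

/-- The Hermitian matrix with eigenvalues `lam` and eigenvectors the columns of `U`. -/
noncomputable def conjDiag {n : ℕ} (U : Matrix (Fin n) (Fin n) ℂ) (lam : Fin n → ℝ) :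
    Matrix (Fin n) (Fin n) ℂ :=
  U * diagonal (fun i => (lam i : ℂ)) * Uᴴ

lemma conjDiag_isHermitian {n : ℕ} (U : Matrix (Fin n) (Fin n) ℂ) (lam : Fin n → ℝ) :
    (conjDiag U lam).IsHermitian := by
  have h : (diagonal (fun i => (lam i : ℂ)))ᴴ = diagonal (fun i => (lam i : ℂ)) := by
    rw [diagonal_conjTranspose]; congr 1; ext i; simp
  unfold conjDiag Matrix.IsHermitian
  rw [conjTranspose_mul, conjTranspose_mul, conjTranspose_conjTranspose, h, Matrix.mul_assoc]

lemma eigsDesc_antitone {n : ℕ} {A : Matrix (Fin n) (Fin n) ℂ} (hA : A.IsHermitian) :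
    Antitone (eigsDesc hA) := by
  intro i j hij
  exact Tuple.monotone_sort hA.eigenvalues (Fin.rev_le_rev.mpr hij)

lemma eigsDesc_eq_of_charpoly {n : ℕ} {A : Matrix (Fin n) (Fin n) ℂ} (hA : A.IsHermitian)
    {lam : Fin n → ℝ} (hlam : Antitone lam)
    (h : A.charpoly = ∏ i, (Polynomial.X - Polynomial.C (lam i : ℂ))) :
    eigsDesc hA = lam := by
  have h1 := hA.roots_charpoly_eq_eigenvalues
  have h2 : (∏ i, (Polynomial.X - Polynomial.C (lam i : ℂ))).roots =
      (Finset.univ.val.map lam).map (RCLike.ofReal : ℝ → ℂ) := by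
    rw [← Polynomial.roots_multiset_prod_X_sub_C
      ((Finset.univ.val.map lam).map (RCLike.ofReal : ℝ → ℂ)), Multiset.map_map, Multiset.map_map]
    rfl
  rw [h, h2, ← Multiset.map_map] at h1
  have h3 := Multiset.map_injective (RCLike.ofReal_injective (K := ℂ)) h1
  have h4 : List.Perm (List.ofFn (eigsDesc hA)) (List.ofFn hA.eigenvalues) :=
    Equiv.Perm.ofFn_comp_perm (Fin.revPerm.trans (Tuple.sort hA.eigenvalues)) hA.eigenvalues
  rw [Fin.univ_val_map, Fin.univ_val_map, Multiset.coe_eq_coe] at h3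
  exact List.ofFn_injective ((h4.trans h3.symm).eq_of_pairwise'
    (eigsDesc_antitone hA).sortedGE_ofFn.pairwise hlam.sortedGE_ofFn.pairwise)

lemma charpoly_conjDiag {n : ℕ} {U : Matrix (Fin n) (Fin n) ℂ} (hU : Uᴴ * U = 1)
    (lam : Fin n → ℝ) :
    (conjDiag U lam).charpoly = ∏ i, (Polynomial.X - Polynomial.C (lam i : ℂ)) := by
  unfold conjDiag
  rw [Matrix.charpoly_mul_comm, ← Matrix.mul_assoc, hU, Matrix.one_mul, charpoly_diagonal]

lemma eigsDesc_conjDiag {n : ℕ} {U A : Matrix (Fin n) (Fin n) ℂ} (hU : Uᴴ * U = 1)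
    {lam : Fin n → ℝ} (hlam : Antitone lam) (hA : A.IsHermitian) (h : A = conjDiag U lam) :
    eigsDesc hA = lam := by
  apply eigsDesc_eq_of_charpoly hA hlam
  rw [h, charpoly_conjDiag hU]

lemma exists_conjDiag_eigsDesc {n : ℕ} {A : Matrix (Fin n) (Fin n) ℂ} (hA : A.IsHermitian) :
    ∃ U : Matrix (Fin n) (Fin n) ℂ, Uᴴ * U = 1 ∧ A = conjDiag U (eigsDesc hA) := by
  set e : Equiv.Perm (Fin n) := Fin.revPerm.trans (Tuple.sort hA.eigenvalues) with he
  set V : Matrix (Fin n) (Fin n) ℂ := (hA.eigenvectorUnitary : Matrix (Fin n) (Fin n) ℂ)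
  have hV : Vᴴ * V = 1 := by
    simpa [star_eq_conjTranspose] using Unitary.coe_star_mul_self hA.eigenvectorUnitary
  refine ⟨V.submatrix id e, ?_, ?_⟩
  · rw [conjTranspose_submatrix, ← submatrix_mul _ _ _ id _ Function.bijective_id, hV,
      submatrix_one_equiv]
  · have h1 : A = V * diagonal (fun i => (hA.eigenvalues i : ℂ)) * Vᴴ := by
      conv_lhs => rw [hA.spectral_theorem, Unitary.conjStarAlgAut_apply]
      rfl
    have h2 : diagonal (fun i => (eigsDesc hA i : ℂ)) =
        (diagonal (fun i => (hA.eigenvalues i : ℂ))).submatrix e e := by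
      rw [submatrix_diagonal_equiv]; rfl
    unfold conjDiag
    rw [h2, submatrix_mul_equiv, conjTranspose_submatrix, submatrix_mul_equiv]
    simpa using h1

/-- The Hermitian matrix `[[0, A], [Aᴴ, 0]]`. -/
noncomputable def dilation {p q : ℕ} (A : Matrix (Fin p) (Fin q) ℂ) :
    Matrix (Fin p ⊕ Fin q) (Fin p ⊕ Fin q) ℂ :=
  fromBlocks 0 A Aᴴ 0

open Polynomial in
lemma charpoly_dilation_mul {p q : ℕ} (A : Matrix (Fin p) (Fin q) ℂ) :
    (dilation A).charpoly * X ^ q = X ^ p * (Aᴴ * A).charpoly.comp (X ^ 2) := by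
  have h1 : (dilation A).charmatrix =
      fromBlocks (scalar (Fin p) X) (-A.map C) (-Aᴴ.map C) (scalar (Fin q) X) := by
    rw [dilation, charmatrix_fromBlocks]
    simp [charmatrix]
  have h2 : (Aᴴ * A).charpoly.comp (X ^ 2) =
      (scalar (Fin q) ((X : ℂ[X]) ^ 2) - Aᴴ.map C * A.map C).det := by
    rw [Matrix.charpoly, ← Polynomial.coe_compRingHom_apply, RingHom.map_det]
    congr 1
    ext i j : 1
    by_cases hij : i = j
    · subst hij
      simp [charmatrix_apply_eq, ← Matrix.map_mul]
    · simp [← Matrix.map_mul, hij]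
  have h3 : (fromBlocks (scalar (Fin p) X) (-A.map C) (-Aᴴ.map C) (scalar (Fin q) X)) *
      (fromBlocks 1 (A.map C) 0 (scalar (Fin q) (X : ℂ[X]))) =
      fromBlocks (scalar (Fin p) X) 0 (-Aᴴ.map C)
        (scalar (Fin q) ((X : ℂ[X]) ^ 2) - Aᴴ.map C * A.map C) := by
    rw [fromBlocks_multiply]
    congr 1
    · simp
    · ext i j : 1
      rw [Matrix.add_apply, scalar_apply, scalar_apply, diagonal_mul, mul_diagonal,
        Matrix.neg_apply, Matrix.zero_apply]
      ring
    · simp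
    · ext i j : 1
      simp [pow_two, sub_eq_neg_add]
  have h4 := congrArg det h3
  rw [det_mul, det_fromBlocks_zero₂₁, det_fromBlocks_zero₁₂, ← h1, ← h2] at h4
  simpa [Matrix.charpoly] using h4

lemma singularValues_nonneg {p q : ℕ} (A : Matrix (Fin p) (Fin q) ℂ) (i : Fin q) :
    0 ≤ singularValues A i := Real.sqrt_nonneg _

lemma singularValues_antitone {p q : ℕ} (A : Matrix (Fin p) (Fin q) ℂ) :
    Antitone (singularValues A) := fun _ _ h => Real.sqrt_le_sqrt (eigsDesc_antitone _ h)

open scoped ComplexOrder in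
lemma sq_singularValues {p q : ℕ} (A : Matrix (Fin p) (Fin q) ℂ) (i : Fin q) :
    singularValues A i ^ 2 = eigsDesc (isHermitian_conjTranspose_mul_self A) i :=
  Real.sq_sqrt ((posSemidef_conjTranspose_mul_self A).eigenvalues_nonneg _)

open Polynomial in
lemma charpoly_eq_prod_eigsDesc {n : ℕ} {A : Matrix (Fin n) (Fin n) ℂ} (hA : A.IsHermitian) :
    A.charpoly = ∏ i, (X - C (eigsDesc hA i : ℂ)) := by
  rw [hA.charpoly_eq]
  exact (Equiv.prod_comp (Fin.revPerm.trans (Tuple.sort hA.eigenvalues))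
    (fun i => (X - C (hA.eigenvalues i : ℂ)))).symm

open Polynomial in
lemma charpoly_dilation {p q : ℕ} (hpq : q ≤ p) (A : Matrix (Fin p) (Fin q) ℂ) :
    (dilation A).charpoly = X ^ (p - q) *
      ((∏ i, (X - C (singularValues A i : ℂ))) * ∏ i, (X - C (-(singularValues A i : ℂ)))) := by
  have h := charpoly_dilation_mul A
  have h1 : (Aᴴ * A).charpoly.comp (X ^ 2) =
      (∏ i, (X - C (singularValues A i : ℂ))) * ∏ i, (X - C (-(singularValues A i : ℂ))) := by
    rw [charpoly_eq_prod_eigsDesc (isHermitian_conjTranspose_mul_self A), Polynomial.prod_comp,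
      ← Finset.prod_mul_distrib]
    refine Finset.prod_congr rfl fun i _ => ?_
    rw [← sq_singularValues]
    rw [sub_comp, X_comp, C_comp, Complex.ofReal_pow, map_neg, C_pow]
    ring
  refine mul_right_cancel₀ (pow_ne_zero q (X_ne_zero (R := ℂ))) ?_
  rw [h, h1, ← pow_sub_mul_pow (X : ℂ[X]) hpq]
  ring

lemma tildeVec_lt {p q : ℕ} (x : Fin q → ℝ) (k : Fin (p + q)) (h : k.val < q) :
    tildeVec p q x k = x ⟨k.val, h⟩ := by simp [tildeVec, h]

lemma tildeVec_injective {p q : ℕ} : Function.Injective (tildeVec p q) := by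
  intro x y h
  ext i
  have := congrFun h ⟨i.val, by omega⟩
  rwa [tildeVec_lt _ _ i.isLt, tildeVec_lt _ _ i.isLt] at this

lemma tildeVec_antitone {p q : ℕ} {x : Fin q → ℝ} (hx : DecrNonneg x) :
    Antitone (tildeVec p q x) := by
  intro i j hij
  have hij' : i.val ≤ j.val := hij
  unfold tildeVec
  split_ifs
  all_goals first
    | omega
    | exact hx.1 _ _ hij'
    | exact hx.2 _
    | exact le_rfl
    | exact neg_nonpos.mpr (hx.2 _)
    | exact (neg_nonpos.mpr (hx.2 _)).trans (hx.2 _)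
    | exact neg_le_neg (hx.1 _ _ (Nat.sub_le_sub_left hij' _))

open Polynomial in
lemma prod_tildeVec {p q : ℕ} (hpq : q ≤ p) (x : Fin q → ℝ) :
    ∏ k, (X - C (tildeVec p q x k : ℂ)) = X ^ (p - q) *
      ((∏ i, (X - C (x i : ℂ))) * ∏ i, (X - C (-(x i : ℂ)))) := by
  obtain ⟨r, rfl⟩ := Nat.exists_eq_add_of_le hpq
  rw [Fin.prod_univ_add, Fin.prod_univ_add, ← Equiv.prod_comp Fin.revPerm
    (fun i => (X - C (-(x i : ℂ))))]
  have h1 : ∀ i : Fin q, tildeVec (q + r) q x (Fin.castAdd q (Fin.castAdd r i)) = x i := by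
    intro i; simp [tildeVec]
  have h2 : ∀ i : Fin r, tildeVec (q + r) q x (Fin.castAdd q (Fin.natAdd q i)) = 0 := by
    intro i; simp only [tildeVec, Fin.val_castAdd, Fin.val_natAdd]
    rw [dif_neg (by omega), dif_pos (by omega)]
  have h3 : ∀ i : Fin q, tildeVec (q + r) q x (Fin.natAdd (q + r) i) = -x i.rev := by
    intro i
    have : ¬ (q + r + i.val < q) := by omega
    simp only [tildeVec, Fin.val_natAdd, this, dite_false]
    rw [dif_neg (by omega)]
    congr 2
    ext
    simp only [Fin.val_rev]
    omega
  simp only [h1, h2, h3]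
  simp only [Complex.ofReal_zero, map_zero, sub_zero, Finset.prod_const, Finset.card_univ,
    Fintype.card_fin, Complex.ofReal_neg, Fin.revPerm_apply, Nat.add_sub_cancel_left]
  ring

lemma eigsDesc_conj_dilation {p q : ℕ} (hpq : q ≤ p) (A : Matrix (Fin p) (Fin q) ℂ)
    {W : Matrix (Fin (p + q)) (Fin p ⊕ Fin q) ℂ} (hW : Wᴴ * W = 1)
    (hM : (W * dilation A * Wᴴ).IsHermitian) :
    eigsDesc hM = tildeVec p q (singularValues A) := by
  refine eigsDesc_eq_of_charpoly hM (tildeVec_antitone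
    ⟨fun i j h => singularValues_antitone A h, singularValues_nonneg A⟩) ?_
  rw [prod_tildeVec hpq, ← charpoly_dilation hpq]
  have h := charpoly_mul_comm' (W * dilation A) Wᴴ
  rw [← Matrix.mul_assoc, hW, Matrix.one_mul] at h
  simp only [Fintype.card_fin, Fintype.card_sum] at h
  exact mul_left_cancel₀ (pow_ne_zero _ (Polynomial.X_ne_zero (R := ℂ))) h

lemma conj_dilation_isHermitian {p q : ℕ} (A : Matrix (Fin p) (Fin q) ℂ)
    (W : Matrix (Fin (p + q)) (Fin p ⊕ Fin q) ℂ) : (W * dilation A * Wᴴ).IsHermitian := by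
  unfold Matrix.IsHermitian dilation
  rw [conjTranspose_mul, conjTranspose_mul, conjTranspose_conjTranspose, fromBlocks_conjTranspose,
    Matrix.mul_assoc]
  simp

/-- The permutation matrix of a self-map `σ`. -/
def permOf {n : ℕ} (σ : Fin n → Fin n) : Matrix (Fin n) (Fin n) ℂ :=
  fun i j => if σ i = j then 1 else 0

lemma permOf_mul {n : ℕ} (σ : Fin n → Fin n) {m : Type*} (M : Matrix (Fin n) m ℂ) (i : Fin n)
    (j : m) : (permOf σ * M) i j = M (σ i) j := by
  simp [Matrix.mul_apply, permOf]

lemma permOf_conjTranspose {n : ℕ} {σ : Fin n → Fin n} (hσ : Function.Involutive σ) :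
    (permOf σ)ᴴ = permOf σ := by
  ext i j
  have : σ j = i ↔ σ i = j := ⟨fun h => by rw [← h, hσ], fun h => by rw [← h, hσ]⟩
  simp only [conjTranspose_apply, permOf, this]
  split_ifs <;> simp

lemma permOf_mul_self {n : ℕ} {σ : Fin n → Fin n} (hσ : Function.Involutive σ) :
    permOf σ * permOf σ = 1 := by
  ext i j
  rw [permOf_mul]
  simp [permOf, hσ i, Matrix.one_apply]

/-- The diagonal matrix with `p` entries `1` followed by `q` entries `-1`. -/
def signMat (p q : ℕ) : Matrix (Fin p ⊕ Fin q) (Fin p ⊕ Fin q) ℂ :=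
  fromBlocks 1 0 0 (-1)

lemma signMat_conjTranspose (p q : ℕ) : (signMat p q)ᴴ = signMat p q := by
  simp [signMat, fromBlocks_conjTranspose]

lemma exists_unitary_diagonalizing_involution {p q : ℕ}
    {J : Matrix (Fin (p + q)) (Fin (p + q)) ℂ} (hJ : J.IsHermitian) (hJJ : J * J = 1)
    (htr : J.trace = (p : ℂ) - q) :
    ∃ W : Matrix (Fin (p + q)) (Fin p ⊕ Fin q) ℂ, Wᴴ * W = 1 ∧ W * Wᴴ = 1 ∧
      J * W = W * signMat p q := by
  obtain ⟨V, hV, hJV⟩ := exists_conjDiag_eigsDesc hJ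
  set d := eigsDesc hJ
  have hV' : V * Vᴴ = 1 := mul_eq_one_comm.mp hV
  have hJV1 : J * V = V * diagonal (fun i => (d i : ℂ)) := by
    rw [hJV, conjDiag, Matrix.mul_assoc, hV, Matrix.mul_one]
  have hdd : ∀ i, d i = 1 ∨ d i = -1 := by
    intro i
    have h1 : V * (diagonal (fun i => (d i : ℂ)) * diagonal (fun i => (d i : ℂ))) = V := by
      rw [← Matrix.mul_assoc, ← hJV1, Matrix.mul_assoc, ← hJV1, ← Matrix.mul_assoc, hJJ,
        Matrix.one_mul]
    have h2 : diagonal (fun i => (d i : ℂ)) * diagonal (fun i => (d i : ℂ)) = 1 := by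
      have := congrArg (Vᴴ * ·) h1
      simpa only [← Matrix.mul_assoc, hV, Matrix.one_mul] using this
    have h3 := congrFun (congrFun h2 i) i
    rw [diagonal_mul_diagonal, diagonal_apply_eq, one_apply_eq] at h3
    exact mul_self_eq_one_iff.mp (by exact_mod_cast h3)
  have hsum : ∑ i, d i = (p : ℝ) - q := by
    have h1 : J.trace = ∑ i, (d i : ℂ) := by
      rw [hJV, conjDiag, Matrix.trace_mul_comm, ← Matrix.mul_assoc, hV, Matrix.one_mul,
        trace_diagonal]
    rw [htr] at h1
    exact_mod_cast h1.symm
  have hcard : Fintype.card {i // d i = 1} = p := by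
    have h1 : ∀ i, d i = 2 * (if d i = 1 then 1 else 0) - 1 := by
      intro i
      rcases hdd i with h | h <;> rw [h] <;> norm_num
    rw [Finset.sum_congr rfl fun i _ => h1 i, Finset.sum_sub_distrib, ← Finset.mul_sum,
      Finset.sum_boole] at hsum
    rw [Fintype.card_subtype]
    simp only [Finset.sum_const, Finset.card_univ, Fintype.card_fin, nsmul_eq_mul,
      Nat.cast_add] at hsum
    have : ((Finset.univ.filter fun i => d i = 1).card : ℝ) = p := by linarith
    exact_mod_cast this
  have hcard' : Fintype.card {i // ¬ d i = 1} = q := by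
    rw [Fintype.card_subtype_compl, hcard, Fintype.card_fin, Nat.add_sub_cancel_left]
  let e : Fin p ⊕ Fin q ≃ Fin (p + q) :=
    (Equiv.sumCongr (Fintype.equivFinOfCardEq hcard).symm
      (Fintype.equivFinOfCardEq hcard').symm).trans (Equiv.sumCompl fun i => d i = 1)
  have he1 : ∀ i, d (e (Sum.inl i)) = 1 := fun i =>
    ((Fintype.equivFinOfCardEq hcard).symm i).2
  have he2 : ∀ i, d (e (Sum.inr i)) = -1 := fun i =>
    (hdd _).resolve_left ((Fintype.equivFinOfCardEq hcard').symm i).2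
  refine ⟨V.submatrix id e, ?_, ?_, ?_⟩
  · rw [conjTranspose_submatrix, ← submatrix_mul _ _ _ id _ Function.bijective_id, hV,
      submatrix_one_equiv]
  · rw [conjTranspose_submatrix, submatrix_mul_equiv, hV', submatrix_id_id]
  · have h1 : signMat p q = (diagonal (fun i => (d i : ℂ))).submatrix e e := by
      rw [submatrix_diagonal_equiv]
      ext i j
      rcases i with i | i <;> rcases j with j | j <;>
        simp [signMat, diagonal_apply, he1, he2, Matrix.one_apply]
      split_ifs <;> simp
    rw [h1, submatrix_mul_equiv, ← hJV1]
    ext i j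
    simp [Matrix.mul_apply]

/-- The involution of `Fin (p + q)` matching each index with that of the opposite entry of
`tildeVec p q x`. -/
def foldIdx (p q : ℕ) (k : Fin (p + q)) : Fin (p + q) :=
  if q ≤ k.val ∧ k.val < p then k else k.rev

lemma foldIdx_involutive (p q : ℕ) : Function.Involutive (foldIdx p q) := by
  intro k
  unfold foldIdx
  by_cases h : q ≤ k.val ∧ k.val < p
  · simp [h]
  · have h' : ¬ (q ≤ k.rev.val ∧ k.rev.val < p) := by
      rw [Fin.val_rev]; omega
    rw [if_neg h, if_neg h', Fin.rev_rev]

lemma tildeVec_foldIdx {p q : ℕ} (hpq : q ≤ p) (x : Fin q → ℝ) (k : Fin (p + q)) :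
    tildeVec p q x (foldIdx p q k) = -tildeVec p q x k := by
  unfold foldIdx
  have hk := k.isLt
  by_cases h : q ≤ k.val ∧ k.val < p
  · rw [if_pos h]
    simp only [tildeVec]
    rw [dif_neg (by omega), dif_pos h.2, neg_zero]
  · rw [if_neg h]
    simp only [tildeVec, Fin.val_rev]
    by_cases h1 : k.val < q
    · rw [dif_neg (by omega), dif_neg (by omega), dif_pos h1]
      congr 2
      ext
      simp only
      omega
    · rw [dif_pos (by omega), dif_neg h1, dif_neg (by omega), neg_neg]
      congr 1
      ext
      simp only
      omega

lemma trace_permOf_foldIdx {p q : ℕ} (hpq : q ≤ p) :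
    (permOf (foldIdx p q)).trace = (p : ℂ) - q := by
  have h1 : ∀ k : Fin (p + q), foldIdx p q k = k ↔ q ≤ k.val ∧ k.val < p := by
    intro k
    unfold foldIdx
    by_cases h : q ≤ k.val ∧ k.val < p
    · simp [h]
    · rw [if_neg h]
      simp only [h, iff_false, Fin.ext_iff, Fin.val_rev]
      omega
  have h2 : (permOf (foldIdx p q)).trace =
      ∑ k ∈ Finset.range (p + q), if q ≤ k ∧ k < p then (1 : ℂ) else 0 := by
    rw [Finset.sum_range]
    simp [Matrix.trace, permOf, h1]
  have h3 : (Finset.range (p + q)).filter (fun k => q ≤ k ∧ k < p) = Finset.Ico q p := by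
    ext k
    simp only [Finset.mem_filter, Finset.mem_range, Finset.mem_Ico]
    omega
  rw [h2, Finset.sum_boole, h3, Nat.card_Ico, Nat.cast_sub hpq]

lemma exists_eq_dilation {p q : ℕ} {N : Matrix (Fin p ⊕ Fin q) (Fin p ⊕ Fin q) ℂ}
    (hN : N.IsHermitian)
    (h : signMat p q * N * signMat p q = -N) :
    ∃ A : Matrix (Fin p) (Fin q) ℂ, N = dilation A := by
  obtain ⟨a, b, c, d, rfl⟩ : ∃ a b c d, N = fromBlocks a b c d :=
    ⟨_, _, _, _, (fromBlocks_toBlocks N).symm⟩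
  rw [signMat, fromBlocks_multiply, fromBlocks_multiply, fromBlocks_neg, fromBlocks_inj] at h
  obtain ⟨ha, -, -, hd⟩ := h
  simp only [Matrix.one_mul, Matrix.zero_mul, Matrix.mul_one, Matrix.mul_zero, add_zero, zero_add,
    Matrix.neg_mul, Matrix.mul_neg, neg_neg] at ha hd
  have hc := (isHermitian_fromBlocks_iff.mp hN).2.1
  have ha' : a = 0 := by
    ext i j
    exact self_eq_neg.mp (congrFun (congrFun ha i) j)
  have hd' : d = 0 := by
    ext i j
    exact self_eq_neg.mp (congrFun (congrFun hd i) j)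
  refine ⟨b, ?_⟩
  rw [dilation, ha', hd', hc]

lemma mem_Horn_of_mem_SingularCone {p q : ℕ} (hpq : q ≤ p) {x y z : Fin q → ℝ}
    (h : (x, y, z) ∈ SingularCone p q) :
    (tildeVec p q x, tildeVec p q y, tildeVec p q z) ∈ Horn (p + q) := by
  obtain ⟨A, B, C, hsum, hA, hB, hC⟩ := h
  simp only at hA hB hC
  obtain ⟨W, hW, -⟩ := exists_unitary_diagonalizing_involution
    (permOf_conjTranspose (foldIdx_involutive p q)) (permOf_mul_self (foldIdx_involutive p q))
    (trace_permOf_foldIdx hpq)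
  refine ⟨_, _, _, conj_dilation_isHermitian A W, conj_dilation_isHermitian B W,
    conj_dilation_isHermitian C W, ?_, ?_, ?_, ?_⟩
  · have h1 : dilation A + dilation B + dilation C = 0 := by
      simp only [dilation, fromBlocks_add, ← conjTranspose_add, hsum]
      simp
    rw [← Matrix.add_mul, ← Matrix.add_mul, ← Matrix.mul_add, ← Matrix.mul_add, h1]
    simp
  · rw [eigsDesc_conj_dilation hpq A hW, hA]
  · rw [eigsDesc_conj_dilation hpq B hW, hB]
  · rw [eigsDesc_conj_dilation hpq C hW, hC]

lemma exists_unitary_mul_upperTriangular {n : ℕ} (g : Matrix (Fin n) (Fin n) ℂ) :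
    ∃ u b : Matrix (Fin n) (Fin n) ℂ, uᴴ * u = 1 ∧ b.BlockTriangular id ∧ g = u * b := by
  set f : Fin n → EuclideanSpace ℂ (Fin n) := fun j => WithLp.toLp 2 (g.col j)
  have hdim : Module.finrank ℂ (EuclideanSpace ℂ (Fin n)) = Fintype.card (Fin n) := by simp
  set e := InnerProductSpace.gramSchmidtOrthonormalBasis hdim f
  refine ⟨(EuclideanSpace.basisFun (Fin n) ℂ).toBasis.toMatrix e, e.toBasis.toMatrix f, ?_,
    InnerProductSpace.gramSchmidtOrthonormalBasis_inv_isUpperTriangular hdim f, ?_⟩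
  · have := (EuclideanSpace.basisFun (Fin n) ℂ).toMatrix_orthonormalBasis_mem_unitary e
    exact (Matrix.mem_unitaryGroup_iff'.mp this)
  · have h := (EuclideanSpace.basisFun (Fin n) ℂ).toBasis.toMatrix_mul_toMatrix e.toBasis f
    rw [e.coe_toBasis] at h
    rw [h]
    ext i j
    simp [Module.Basis.toMatrix_apply, f]

lemma conj_conjDiag_eq_neg {n : ℕ} {σ : Fin n → Fin n} (hσ : Function.Involutive σ)
    {lam : Fin n → ℝ} (hanti : Antitone lam) (hflip : ∀ i, lam (σ i) = -lam i)
    {g u b : Matrix (Fin n) (Fin n) ℂ} (hg : gᴴ * permOf σ * g = permOf σ) (hu : uᴴ * u = 1)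
    (hb : b.BlockTriangular id) (hgub : g = u * b) :
    permOf σ * conjDiag u lam * permOf σ = -conjDiag u lam := by
  set J := permOf σ with hJdef
  have hJJ : J * J = 1 := permOf_mul_self hσ
  have hu' : u * uᴴ = 1 := mul_eq_one_comm.mp hu
  have hgi : J * gᴴ * J * g = 1 := by rw [Matrix.mul_assoc J, Matrix.mul_assoc J, hg, hJJ]
  set c := J * gᴴ * J * u with hc
  have hcb : c * b = 1 := by rw [hc, Matrix.mul_assoc, ← hgub, hgi]
  have hbc : b * c = 1 := mul_eq_one_comm.mp hcb
  have hcinv : b⁻¹ = c := inv_eq_right_inv hbc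
  have hctri : c.BlockTriangular id := by
    let _ := invertibleOfRightInverse b c hbc
    rw [← hcinv]
    exact blockTriangular_inv_of_blockTriangular hb
  set J1 := uᴴ * J * u with hJ1
  have hJ1J1 : J1 * J1 = 1 := by
    calc J1 * J1 = uᴴ * J * (u * uᴴ) * J * u := by rw [hJ1]; simp only [Matrix.mul_assoc]
      _ = uᴴ * (J * J) * u := by rw [hu', Matrix.mul_one]; simp only [Matrix.mul_assoc]
      _ = 1 := by rw [hJJ, Matrix.mul_one, hu]
  have hbJ : bᴴ * J1 * b = J := by
    rw [← hg, hgub, conjTranspose_mul, hJ1]; simp only [Matrix.mul_assoc]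
  have hbc' : cᴴ * bᴴ = 1 := by rw [← conjTranspose_mul, hbc, conjTranspose_one]
  have hJ1c : J1 = cᴴ * (J * c) := by
    calc J1 = (cᴴ * bᴴ) * J1 * (b * c) := by rw [hbc', hbc, Matrix.one_mul, Matrix.mul_one]
      _ = cᴴ * ((bᴴ * J1 * b) * c) := by simp only [Matrix.mul_assoc]
      _ = _ := by rw [hbJ]
  have hJ1b : J1 = b * (J * bᴴ) := by
    have h1 : J1 * (b * (J * bᴴ)) = 1 := by
      calc J1 * (b * (J * bᴴ)) = cᴴ * J * (c * b) * J * bᴴ := by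
            rw [hJ1c]; simp only [Matrix.mul_assoc]
        _ = cᴴ * (J * J) * bᴴ := by rw [hcb, Matrix.mul_one]; simp only [Matrix.mul_assoc]
        _ = 1 := by rw [hJJ, Matrix.mul_one, hbc']
    calc J1 = J1 * (J1 * (b * (J * bᴴ))) := by rw [h1, Matrix.mul_one]
      _ = _ := by rw [← Matrix.mul_assoc, hJ1J1, Matrix.one_mul]
  have hle : ∀ i j, J1 i j ≠ 0 → lam i + lam j ≤ 0 := by
    intro i j hij
    rw [hJ1c, Matrix.mul_apply] at hij
    obtain ⟨k, -, hk⟩ := Finset.exists_ne_zero_of_sum_ne_zero hij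
    rw [permOf_mul] at hk
    have h1 : k ≤ i := by
      by_contra h
      exact hk (by rw [conjTranspose_apply, hctri (not_le.mp h)]; simp)
    have h2 : σ k ≤ j := by
      by_contra h
      exact hk (by rw [hctri (not_le.mp h)]; simp)
    linarith [hanti h1, hanti h2, hflip k]
  have hge : ∀ i j, J1 i j ≠ 0 → 0 ≤ lam i + lam j := by
    intro i j hij
    rw [hJ1b, Matrix.mul_apply] at hij
    obtain ⟨k, -, hk⟩ := Finset.exists_ne_zero_of_sum_ne_zero hij
    rw [permOf_mul] at hk
    have h1 : i ≤ k := by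
      by_contra h
      exact hk (by rw [hb (not_le.mp h)]; simp)
    have h2 : j ≤ σ k := by
      by_contra h
      exact hk (by rw [conjTranspose_apply, hb (not_le.mp h)]; simp)
    linarith [hanti h1, hanti h2, hflip k]
  have hcomm : J1 * diagonal (fun i => (lam i : ℂ)) = -(diagonal (fun i => (lam i : ℂ)) * J1) := by
    ext i j
    rw [mul_diagonal, neg_apply, diagonal_mul]
    by_cases h : J1 i j = 0
    · rw [h]; simp
    · have h1 : (lam j : ℂ) = -(lam i : ℂ) := by
        exact_mod_cast (by linarith [hle i j h, hge i j h] : lam j = -lam i)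
      rw [h1]; ring
  have hJu : J * u = u * J1 := by
    rw [hJ1, ← Matrix.mul_assoc, ← Matrix.mul_assoc, hu', Matrix.one_mul]
  have huJ : uᴴ * J = J1 * uᴴ := by
    rw [hJ1, Matrix.mul_assoc, hu', Matrix.mul_one]
  calc J * conjDiag u lam * J
      = (J * u) * diagonal (fun i => (lam i : ℂ)) * (uᴴ * J) := by
        unfold conjDiag; simp only [Matrix.mul_assoc]
    _ = u * (J1 * diagonal (fun i => (lam i : ℂ))) * J1 * uᴴ := by
        rw [hJu, huJ]; simp only [Matrix.mul_assoc]
    _ = -(u * diagonal (fun i => (lam i : ℂ)) * (J1 * J1) * uᴴ) := by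
        rw [hcomm]; simp only [Matrix.mul_assoc, Matrix.mul_neg, Matrix.neg_mul]
    _ = _ := by rw [hJ1J1, Matrix.mul_one]; rfl

/-- The coefficients of `lam` in the basis of fundamental weights. -/
noncomputable def gap {n : ℕ} (lam : Fin n → ℝ) (k : Fin n) : ℝ :=
  if h : k.val + 1 < n then lam k - lam ⟨k.val + 1, h⟩ else lam k

lemma gap_nonneg {n : ℕ} {lam : Fin n → ℝ} (hanti : Antitone lam) {k : Fin n}
    (hk : k.val + 1 < n) : 0 ≤ gap lam k := by
  rw [gap, dif_pos hk, sub_nonneg]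
  exact hanti (Fin.le_def.mpr (Nat.le_succ _))

lemma sum_gap {n : ℕ} (lam : Fin n → ℝ) (i : Fin n) :
    ∑ k, (if i ≤ k then gap lam k else 0) = lam i := by
  set L : ℕ → ℝ := fun m => if h : m < n then lam ⟨m, h⟩ else 0
  have h1 : ∀ k : Fin n, gap lam k = L k.val - L (k.val + 1) := by
    intro k
    simp only [gap, L, k.isLt, dite_true]
    split_ifs <;> simp
  have h2 : ∑ k, (if i ≤ k then gap lam k else 0) =
      ∑ k ∈ Finset.range n, if i.val ≤ k then L k - L (k + 1) else 0 := by
    rw [Finset.sum_range]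
    exact Finset.sum_congr rfl fun k _ => by rw [h1]; rfl
  have h3 : (Finset.range n).filter (fun k => i.val ≤ k) = Finset.Ico i.val n := by
    ext k; simp only [Finset.mem_filter, Finset.mem_range, Finset.mem_Ico]; omega
  rw [h2, ← Finset.sum_filter, h3, Finset.sum_Ico_eq_sub _ i.isLt.le, Finset.sum_range_sub',
    Finset.sum_range_sub']
  simp [L]

lemma sum_gap_mul_sum {n : ℕ} (lam f : Fin n → ℝ) :
    ∑ k, gap lam k * ∑ i, (if i ≤ k then f i else 0) = ∑ i, lam i * f i := by
  simp_rw [Finset.mul_sum]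
  rw [Finset.sum_comm]
  refine Finset.sum_congr rfl fun i _ => ?_
  rw [← sum_gap lam i, Finset.sum_mul]
  refine Finset.sum_congr rfl fun k _ => ?_
  split_ifs <;> simp

/-- The submatrix of the columns of `M` up to `k`. -/
def cols {m : Type*} {R : Type*} {n : ℕ} (M : Matrix m (Fin n) R) (k : Fin n) :
    Matrix m {i : Fin n // i ≤ k} R :=
  M.submatrix id Subtype.val

lemma cols_mul {l m R : Type*} [Fintype m] [NonUnitalNonAssocSemiring R] {n : ℕ}
    (M : Matrix l m R) (N : Matrix m (Fin n) R) (k : Fin n) :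
    cols (M * N) k = M * cols N k := rfl

/-- The leading principal submatrix with indices up to `k`. -/
def lead {R : Type*} {n : ℕ} (M : Matrix (Fin n) (Fin n) R) (k : Fin n) :
    Matrix {i : Fin n // i ≤ k} {i : Fin n // i ≤ k} R :=
  M.submatrix Subtype.val Subtype.val

lemma cols_mul_of_blockTriangular {m : Type*} {n : ℕ} (M : Matrix m (Fin n) ℂ)
    {b : Matrix (Fin n) (Fin n) ℂ} (hb : b.BlockTriangular id) (k : Fin n) :
    cols (M * b) k = cols M k * lead b k := by
  ext i j
  simp only [cols, lead, submatrix_apply, Matrix.mul_apply, id]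
  rw [← Fintype.sum_subtype_add_sum_subtype (fun x => x ≤ k) (fun x => M i x * b x j), add_eq_left]
  exact Finset.sum_eq_zero fun x _ => by
    rw [hb (j.2.trans_lt (not_le.mp x.2)), mul_zero]

/-- The Mumford–Hilbert semistability of the triple of flags spanned by the leading columns of
`g j` with weights `lam j`. -/
def Semistable {n : ℕ} (lam : Fin 3 → Fin n → ℝ) (g : Fin 3 → Matrix (Fin n) (Fin n) ℂ) : Prop :=
  ∀ (m : ℕ) (Q : Matrix (Fin m) (Fin n) ℂ), Q * Qᴴ = 1 →
    0 ≤ ∑ j, ∑ k, gap (lam j) k * ((cols (Q * g j) k).rank : ℝ)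

open scoped ComplexOrder in
lemma re_trace_mul_conjTranspose_le_rank {m ι : Type*} [Fintype m] [DecidableEq m] [Fintype ι]
    (M : Matrix m ι ℂ) (hM : (1 - M * Mᴴ).PosSemidef) :
    (M * Mᴴ).trace.re ≤ M.rank := by
  have hA : (M * Mᴴ).IsHermitian := isHermitian_mul_conjTranspose_self M
  have hle : ∀ i, hA.eigenvalues i ≤ 1 := by
    intro i
    have h1 := hM.re_dotProduct_nonneg (hA.eigenvectorBasis i)
    have h2 := hA.eigenvalues_eq i
    rw [sub_mulVec, one_mulVec, dotProduct_sub, map_sub, ← h2] at h1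
    have h3 : star (hA.eigenvectorBasis i : m → ℂ) ⬝ᵥ (hA.eigenvectorBasis i : m → ℂ) = 1 := by
      have := hA.eigenvectorBasis.inner_eq_one i
      rwa [EuclideanSpace.inner_eq_star_dotProduct, dotProduct_comm] at this
    rw [h3] at h1
    simpa using h1
  rw [hA.trace_eq_sum_eigenvalues, ← rank_self_mul_conjTranspose M,
    hA.rank_eq_card_non_zero_eigs, Fintype.card_subtype, ← Finset.sum_boole, Complex.re_sum]
  refine Finset.sum_le_sum fun i _ => ?_
  split_ifs with h
  · exact hle i
  · rw [not_not] at h; simp [h]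

lemma re_trace_cols_mul_conjTranspose {m n : ℕ} (M : Matrix (Fin m) (Fin n) ℂ) (k : Fin n) :
    (cols M k * (cols M k)ᴴ).trace.re =
      ∑ i, (if i ≤ k then ∑ a, Complex.normSq (M a i) else 0) := by
  have h1 : (cols M k * (cols M k)ᴴ).trace =
      ∑ i : {i // i ≤ k}, ∑ a, (Complex.normSq (M a i) : ℂ) := by
    rw [Matrix.trace, Finset.sum_comm]
    refine Finset.sum_congr rfl fun a _ => ?_
    rw [diag_apply, Matrix.mul_apply]
    exact Finset.sum_congr rfl fun i _ => Complex.mul_conj _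
  have h2 := Fintype.sum_subtype_add_sum_subtype (fun i => i ≤ k)
    (fun i => if i ≤ k then ∑ a, Complex.normSq (M a i) else 0)
  rw [h1, ← h2, Finset.sum_congr rfl fun (i : {i // i ≤ k}) _ => if_pos i.2,
    Finset.sum_congr rfl fun (i : {i // ¬ i ≤ k}) _ => if_neg i.2]
  simp

open scoped ComplexOrder in
lemma posSemidef_one_sub_cols {m n : ℕ} {M : Matrix (Fin m) (Fin n) ℂ} (hM : M * Mᴴ = 1)
    (k : Fin n) : (1 - cols M k * (cols M k)ᴴ).PosSemidef := by
  have h : 1 - cols M k * (cols M k)ᴴ = (M.submatrix id (Subtype.val : {i // ¬ i ≤ k} → Fin n)) *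
      (M.submatrix id (Subtype.val : {i // ¬ i ≤ k} → Fin n))ᴴ := by
    rw [← hM, sub_eq_iff_eq_add']
    ext a b
    rw [Matrix.add_apply, Matrix.mul_apply, ← Fintype.sum_subtype_add_sum_subtype (fun i => i ≤ k)]
    rfl
  rw [h]
  exact posSemidef_self_mul_conjTranspose _

lemma re_trace_cols_le_rank {m n : ℕ} {M : Matrix (Fin m) (Fin n) ℂ} (hM : M * Mᴴ = 1)
    (k : Fin n) : (cols M k * (cols M k)ᴴ).trace.re ≤ (cols M k).rank :=
  re_trace_mul_conjTranspose_le_rank _ (posSemidef_one_sub_cols hM k)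

lemma sum_gap_mul_re_trace_cols {m n : ℕ} (M : Matrix (Fin m) (Fin n) ℂ) (lam : Fin n → ℝ) :
    ∑ k, gap lam k * (cols M k * (cols M k)ᴴ).trace.re =
      (M * diagonal (fun i => (lam i : ℂ)) * Mᴴ).trace.re := by
  simp_rw [re_trace_cols_mul_conjTranspose]
  rw [sum_gap_mul_sum]
  have h1 : (M * diagonal (fun i => (lam i : ℂ)) * Mᴴ).trace =
      ∑ i, ∑ a, ((lam i * Complex.normSq (M a i) : ℝ) : ℂ) := by
    rw [Matrix.trace, Finset.sum_comm]
    refine Finset.sum_congr rfl fun a _ => ?_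
    rw [diag_apply, Matrix.mul_apply]
    refine Finset.sum_congr rfl fun i _ => ?_
    rw [mul_diagonal, conjTranspose_apply]
    push_cast
    rw [← Complex.mul_conj]
    simp only [RCLike.star_def]
    ring
  rw [h1]
  simp [Finset.mul_sum]

lemma sum_gap_mul_rank_ge {m n : ℕ} {M : Matrix (Fin m) (Fin n) ℂ} (hM : M * Mᴴ = 1)
    {lam : Fin n → ℝ} (hanti : Antitone lam) :
    (M * diagonal (fun i => (lam i : ℂ)) * Mᴴ).trace.re ≤
      ∑ k, gap lam k * ((cols M k).rank : ℝ) := by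
  rw [← sum_gap_mul_re_trace_cols]
  refine Finset.sum_le_sum fun k _ => ?_
  have hle := re_trace_cols_le_rank hM k
  by_cases hk : k.val + 1 < n
  · exact mul_le_mul_of_nonneg_left hle (gap_nonneg hanti hk)
  · have h1 : (cols M k * (cols M k)ᴴ).trace.re = m := by
      have : cols M k * (cols M k)ᴴ = M * Mᴴ := by
        ext a b
        have hall : ∀ i : Fin n, i ≤ k := fun i => Fin.le_def.mpr (by omega)
        exact Fintype.sum_equiv (Equiv.subtypeUnivEquiv hall) _ _ fun i => rfl
      rw [this, hM, trace_one]
      simp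
    have h2 : ((cols M k).rank : ℝ) ≤ m := by
      exact_mod_cast (rank_le_card_height (cols M k)).trans_eq (Fintype.card_fin m)
    rw [le_antisymm hle (h2.trans_eq h1.symm)]

lemma semistable_of_sum_conjDiag_eq_zero {n : ℕ} {lam : Fin 3 → Fin n → ℝ}
    (hanti : ∀ j, Antitone (lam j)) {u : Fin 3 → Matrix (Fin n) (Fin n) ℂ}
    (hu : ∀ j, (u j)ᴴ * u j = 1) (hsum : ∑ j, conjDiag (u j) (lam j) = 0) :
    Semistable lam u := by
  intro m Q hQ
  have h1 : ∀ j, (Q * conjDiag (u j) (lam j) * Qᴴ).trace.re ≤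
      ∑ k, gap (lam j) k * ((cols (Q * u j) k).rank : ℝ) := by
    intro j
    have hM : Q * u j * (Q * u j)ᴴ = 1 := by
      rw [conjTranspose_mul, Matrix.mul_assoc, ← Matrix.mul_assoc (u j),
        mul_eq_one_comm.mp (hu j), Matrix.one_mul, hQ]
    have := sum_gap_mul_rank_ge hM (hanti j)
    convert this using 3
    rw [conjDiag, conjTranspose_mul]
    simp only [Matrix.mul_assoc]
  refine le_trans (le_of_eq ?_) (Finset.sum_le_sum fun j _ => h1 j)
  rw [← Complex.re_sum, ← trace_sum, ← Matrix.sum_mul, ← Matrix.mul_sum, hsum]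
  simp

lemma Semistable.smul {n : ℕ} {lam : Fin 3 → Fin n → ℝ} {g : Fin 3 → Matrix (Fin n) (Fin n) ℂ}
    (h : Semistable lam g) {a : Fin 3 → ℂ} (ha : ∀ j, a j ≠ 0) :
    Semistable lam fun j => a j • g j := by
  intro m Q hQ
  have h1 : ∀ j k, (cols (Q * (a j • g j)) k).rank = (cols (Q * g j) k).rank := by
    intro j k
    rw [Matrix.mul_smul]
    exact rank_smul_of_mem_nonZeroDivisors (cols (Q * g j) k)
      (mem_nonZeroDivisors_of_ne_zero (ha j))
  simp only [h1]
  exact h m Q hQ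

open Polynomial in
lemma exists_ringHom_of_X_sub_C_mem {B : Type*} [CommRing B] [Algebra ℂ[X] B]
    [Algebra.FiniteType ℂ[X] B] (t : ℂ) {P : Ideal B} (hP : P ≠ ⊤)
    (ht : algebraMap ℂ[X] B (X - C t) ∈ P) :
    ∃ ρ : B →+* ℂ, ∀ p : ℂ[X], ρ (algebraMap ℂ[X] B p) = p.eval t := by
  obtain ⟨M, hM, hPM⟩ := Ideal.exists_le_maximal P hP
  let _ : Field (B ⧸ M) := Ideal.Quotient.field M
  let _ : Algebra ℂ (B ⧸ M) := ((algebraMap ℂ[X] (B ⧸ M)).comp C).toAlgebra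
  have : IsScalarTower ℂ ℂ[X] (B ⧸ M) := IsScalarTower.of_algebraMap_eq fun _ => rfl
  have : Algebra.FiniteType ℂ[X] (B ⧸ M) :=
    Algebra.FiniteType.trans (S := B) inferInstance inferInstance
  have : Algebra.FiniteType ℂ (B ⧸ M) :=
    Algebra.FiniteType.trans (S := ℂ[X]) inferInstance inferInstance
  have : Module.Finite ℂ (B ⧸ M) := finite_of_finite_type_of_isJacobsonRing ℂ (B ⧸ M)
  have hbij := IsAlgClosed.algebraMap_bijective_of_isIntegral (k := ℂ) (K := B ⧸ M)
  let ψ : ℂ ≃+* B ⧸ M := RingEquiv.ofBijective (algebraMap ℂ (B ⧸ M)) hbij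
  refine ⟨ψ.symm.toRingHom.comp (Ideal.Quotient.mk M), fun p => ?_⟩
  suffices h : (ψ.symm.toRingHom.comp (Ideal.Quotient.mk M)).comp (algebraMap ℂ[X] B) =
      evalRingHom t from congrArg (fun f => f p) h
  have hC : ∀ c : ℂ, Ideal.Quotient.mk M (algebraMap ℂ[X] B (C c)) = ψ c := fun c => rfl
  refine Polynomial.ringHom_ext (fun c => ?_) ?_
  · simp [hC]
  · have h1 : Ideal.Quotient.mk M (algebraMap ℂ[X] B X) = ψ t := by
      rw [← hC, ← sub_eq_zero, ← map_sub, ← map_sub, Ideal.Quotient.eq_zero_iff_mem]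
      exact hPM ht
    simp [h1]

open Polynomial in
lemma isConstructible_range_comap_algebraMap (B : Type*) [CommRing B] [Algebra ℂ[X] B]
    [Algebra.FiniteType ℂ[X] B] :
    Topology.IsConstructible (Set.range (PrimeSpectrum.comap (algebraMap ℂ[X] B))) := by
  apply PrimeSpectrum.isConstructible_range_comap
  rw [RingHom.finitePresentation_algebraMap]
  exact Algebra.FinitePresentation.of_finiteType.mp inferInstance

open Polynomial in
lemma finite_setOf_not_exists_ringHom {B : Type*} [CommRing B] [Algebra ℂ[X] B]
    [Algebra.FiniteType ℂ[X] B] (hinj : Function.Injective (algebraMap ℂ[X] B)) :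
    {t : ℂ | ¬ ∃ ρ : B →+* ℂ, ∀ p : ℂ[X], ρ (algebraMap ℂ[X] B p) = p.eval t}.Finite := by
  obtain ⟨D, hD⟩ := PrimeSpectrum.exists_constructibleSetData_iff.mpr
    (isConstructible_range_comap_algebraMap B)
  have hbot : (⊥ : Ideal ℂ[X]) ∈ minimalPrimes ℂ[X] := by
    rw [IsDomain.minimalPrimes_eq_singleton_bot]; rfl
  obtain ⟨P, hP, hPbot⟩ := Ideal.exists_comap_eq_of_mem_minimalPrimes_of_injective hinj ⊥ hbot
  have hgen : (⟨⊥, Ideal.isPrime_bot⟩ : PrimeSpectrum ℂ[X]) ∈ D.toSet := by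
    rw [hD]
    exact ⟨⟨P, hP⟩, PrimeSpectrum.ext hPbot⟩
  rw [PrimeSpectrum.ConstructibleSetData.toSet, Set.mem_iUnion₂] at hgen
  obtain ⟨c, hcD, hg, hf⟩ := hgen
  have hg0 : ∀ i, c.g i = 0 := fun i => by simpa using hg ⟨i, rfl⟩
  have hf0 : c.f ≠ 0 := fun h => hf (by simp [h])
  refine (c.f.roots.toFinset.finite_toSet).subset fun t ht => ?_
  by_contra htf
  apply ht
  have hprime : (Ideal.span {X - C t} : Ideal ℂ[X]).IsPrime :=
    (Ideal.span_singleton_prime (X_sub_C_ne_zero t)).mpr (prime_X_sub_C t)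
  have hmem : (⟨_, hprime⟩ : PrimeSpectrum ℂ[X]) ∈ D.toSet := by
    rw [PrimeSpectrum.ConstructibleSetData.toSet, Set.mem_iUnion₂]
    refine ⟨c, hcD, ?_, ?_⟩
    · rintro _ ⟨i, rfl⟩
      simp [hg0]
    · intro h
      have h1 := h rfl
      rw [SetLike.mem_coe, Ideal.mem_span_singleton, dvd_iff_isRoot] at h1
      exact htf (by simp [hf0, h1.eq_zero])
  rw [hD] at hmem
  obtain ⟨Q, hQ⟩ := hmem
  refine exists_ringHom_of_X_sub_C_mem t Q.2.ne_top ?_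
  have h1 : X - C t ∈ (PrimeSpectrum.comap (algebraMap ℂ[X] B) Q).asIdeal := by
    rw [hQ]; exact Ideal.mem_span_singleton_self _
  exact h1

open Polynomial in
lemma finite_compl_of_infinite_zeros {ι : Type*} [Finite ι] (S : Set (MvPolynomial ι ℂ[X]))
    (hS : {t : ℂ | ∃ v : ι → ℂ, ∀ f ∈ S, MvPolynomial.eval₂ (evalRingHom t) v f = 0}.Infinite) :
    {t : ℂ | ¬ ∃ v : ι → ℂ, ∀ f ∈ S, MvPolynomial.eval₂ (evalRingHom t) v f = 0}.Finite := by
  have hinj : Function.Injective (algebraMap ℂ[X] (MvPolynomial ι ℂ[X] ⧸ Ideal.span S)) := by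
    rw [injective_iff_map_eq_zero]
    intro p hp
    have hp' : MvPolynomial.C p ∈ Ideal.span S := Ideal.Quotient.eq_zero_iff_mem.mp hp
    refine Polynomial.eq_zero_of_infinite_isRoot p (hS.mono ?_)
    rintro t ⟨v, hv⟩
    have h1 : Ideal.span S ≤ RingHom.ker (MvPolynomial.eval₂Hom (evalRingHom t) v) :=
      Ideal.span_le.mpr fun f hf => hv f hf
    simpa using h1 hp'
  refine (finite_setOf_not_exists_ringHom (B := MvPolynomial ι ℂ[X] ⧸ Ideal.span S)
    hinj).subset fun t ht hρ => ht ?_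
  obtain ⟨ρ, hρ⟩ := hρ
  refine ⟨fun i => ρ (Ideal.Quotient.mk _ (MvPolynomial.X i)), fun f hf => ?_⟩
  have h1 : ρ.comp (Ideal.Quotient.mk (Ideal.span S)) = MvPolynomial.eval₂Hom (evalRingHom t)
      (fun i => ρ (Ideal.Quotient.mk _ (MvPolynomial.X i))) := by
    refine MvPolynomial.ringHom_ext (fun p => ?_) (fun i => ?_)
    · rw [MvPolynomial.eval₂Hom_C]
      exact hρ p
    · simp
  rw [← MvPolynomial.coe_eval₂Hom, ← h1, RingHom.comp_apply,
    Ideal.Quotient.eq_zero_iff_mem.mpr (Ideal.subset_span hf), map_zero]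

lemma exists_rank_factorization {m ι : Type*} [Fintype m] [Fintype ι] [DecidableEq ι]
    (M : Matrix m ι ℂ) {r : ℕ} (hr : M.rank ≤ r) :
    ∃ (X : Matrix m (Fin r) ℂ) (Y : Matrix (Fin r) ι ℂ), M = X * Y := by
  let V := LinearMap.range M.mulVecLin
  let b := Module.finBasis ℂ V
  have hd : Module.finrank ℂ V ≤ r := hr
  have hmem : ∀ i, M.col i ∈ V := fun i => ⟨Pi.single i 1, by simp⟩
  refine ⟨of fun a c => if h : c.val < Module.finrank ℂ V then (b ⟨c, h⟩ : m → ℂ) a else 0,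
    of fun c i => if h : c.val < Module.finrank ℂ V then b.repr ⟨_, hmem i⟩ ⟨c, h⟩ else 0, ?_⟩
  ext a i
  have h1 := congrArg (fun v : V => (v : m → ℂ) a) (b.sum_repr ⟨_, hmem i⟩)
  simp only [AddSubmonoidClass.coe_finsetSum, Finset.sum_apply, SetLike.val_smul, Pi.smul_apply,
    smul_eq_mul, col_apply] at h1
  rw [Matrix.mul_apply, ← h1]
  rw [← Finset.sum_subset (Finset.subset_univ (Finset.univ.map (Fin.castLEEmb hd)))]
  · rw [Finset.sum_map]
    refine Finset.sum_congr rfl fun c _ => ?_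
    simp [mul_comm]
  · intro c _ hc
    rw [of_apply, dif_neg, zero_mul]
    intro h
    exact hc (Finset.mem_map.mpr ⟨⟨c, h⟩, Finset.mem_univ _, rfl⟩)

lemma isClosed_setOf_rank_le (m ι : Type*) [Finite m] [Fintype ι] [DecidableEq ι] (r : ℕ) :
    IsClosed {M : Matrix m ι ℂ | M.rank ≤ r} := by
  cases nonempty_fintype m
  let T : Matrix m ι ℂ →ₗ[ℂ] ((ι → ℂ) →L[ℂ] (m → ℂ)) :=
    LinearMap.toContinuousLinearMap.toLinearMap ∘ₗ Matrix.toLin'.toLinearMap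
  have hT : Continuous T := LinearMap.continuous_of_finiteDimensional T
  have h := (isOpen_setOfPred_nat_le_rank (𝕜 := ℂ) (E := ι → ℂ) (F := m → ℂ) (r + 1)).preimage hT
  rw [← isOpen_compl_iff]
  convert h using 1
  ext M
  have h1 : (T M : (ι → ℂ) →ₗ[ℂ] (m → ℂ)).rank = (M.rank : Cardinal) := by
    exact (Module.finrank_eq_rank ℂ (LinearMap.range M.mulVecLin)).symm
  rw [Set.mem_compl_iff, Set.mem_ofPred_eq, Set.mem_preimage, Set.mem_ofPred_eq, h1, Nat.cast_le,
    not_le, Nat.succ_le_iff]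

open scoped ComplexOrder MatrixOrder in
lemma exists_mul_orthonormal_rows {m n : ℕ} {Q : Matrix (Fin m) (Fin n) ℂ}
    {L : Matrix (Fin n) (Fin m) ℂ} (hL : Q * L = 1) :
    ∃ P : Matrix (Fin m) (Fin m) ℂ, P * Q * (P * Q)ᴴ = 1 := by
  have hpos : (Q * Qᴴ).PosDef := by
    apply PosDef.mul_conjTranspose_self
    intro v w hvw
    have := congrArg (fun x => x ᵥ* L) hvw
    simpa [vecMul_vecMul, hL] using this
  obtain ⟨B, hB⟩ := CStarAlgebra.nonneg_iff_eq_star_mul_self.mp hpos.posSemidef.nonneg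
  rw [star_eq_conjTranspose] at hB
  have hBdet : IsUnit B.det := by
    have h1 := (isUnit_iff_isUnit_det _).mp hpos.isUnit
    rw [hB, det_mul] at h1
    exact isUnit_of_mul_isUnit_right h1
  have hBdet' : IsUnit Bᴴ.det := by rw [det_conjTranspose]; exact hBdet.star
  refine ⟨(Bᴴ)⁻¹, ?_⟩
  calc (Bᴴ)⁻¹ * Q * ((Bᴴ)⁻¹ * Q)ᴴ = (Bᴴ)⁻¹ * (Q * Qᴴ) * ((Bᴴ)⁻¹)ᴴ := by
        rw [conjTranspose_mul]; simp only [Matrix.mul_assoc]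
    _ = ((Bᴴ)⁻¹ * Bᴴ) * (B * ((Bᴴ)⁻¹)ᴴ) := by rw [hB]; simp only [Matrix.mul_assoc]
    _ = 1 := by
        rw [nonsing_inv_mul _ hBdet', Matrix.one_mul, conjTranspose_nonsing_inv,
          conjTranspose_conjTranspose, mul_nonsing_inv _ hBdet]

/-- The ranks of the leading columns of `G j` at the point `t`, projected along some
subspace with `m`-dimensional quotient, are at most `r`. -/
def RankBounded {n : ℕ} (G : Fin 3 → Matrix (Fin n) (Fin n) (Polynomial ℂ)) (m : ℕ)
    (r : Fin 3 → Fin n → ℕ) (t : ℂ) : Prop :=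
  ∃ Q : Matrix (Fin m) (Fin n) ℂ, Q * Qᴴ = 1 ∧
    ∀ j k, (cols (Q * (G j).map (Polynomial.eval t)) k).rank ≤ r j k

open Polynomial in
lemma exists_polynomial_system_rankBounded {n : ℕ} (G : Fin 3 → Matrix (Fin n) (Fin n) ℂ[X])
    (m : ℕ) (r : Fin 3 → Fin n → ℕ) :
    ∃ (ι : Type) (_ : Finite ι) (S : Set (MvPolynomial ι ℂ[X])), ∀ t : ℂ,
      RankBounded G m r t ↔ ∃ v : ι → ℂ, ∀ f ∈ S, MvPolynomial.eval₂ (evalRingHom t) v f = 0 := by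
  let ι := (Fin m × Fin n) ⊕ (Fin n × Fin m) ⊕
    (Σ jk : Fin 3 × Fin n, Fin m × Fin (r jk.1 jk.2)) ⊕
    (Σ jk : Fin 3 × Fin n, Fin (r jk.1 jk.2) × {i : Fin n // i ≤ jk.2})
  let Q : Matrix (Fin m) (Fin n) (MvPolynomial ι ℂ[X]) := of fun a i => MvPolynomial.X (Sum.inl (a, i))
  let L : Matrix (Fin n) (Fin m) (MvPolynomial ι ℂ[X]) := of fun i a => MvPolynomial.X (Sum.inr (Sum.inl (i, a)))
  let x : ∀ jk : Fin 3 × Fin n, Matrix (Fin m) (Fin (r jk.1 jk.2)) (MvPolynomial ι ℂ[X]) := fun jk =>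
    of fun a c => MvPolynomial.X (Sum.inr (Sum.inr (Sum.inl ⟨jk, (a, c)⟩)))
  let y : ∀ jk : Fin 3 × Fin n, Matrix (Fin (r jk.1 jk.2)) {i : Fin n // i ≤ jk.2} (MvPolynomial ι ℂ[X]) := fun jk =>
    of fun c i => MvPolynomial.X (Sum.inr (Sum.inr (Sum.inr ⟨jk, (c, i)⟩)))
  let g : Fin 3 → Matrix (Fin n) (Fin n) (MvPolynomial ι ℂ[X]) := fun j =>
    (G j).map MvPolynomial.C
  let e1 : Matrix (Fin m) (Fin m) (MvPolynomial ι ℂ[X]) := Q * L - 1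
  let e2 : ∀ jk : Fin 3 × Fin n, Matrix (Fin m) {i : Fin n // i ≤ jk.2} (MvPolynomial ι ℂ[X]) := fun jk =>
    Q * cols (g jk.1) jk.2 - x jk * y jk
  refine ⟨ι, inferInstance, {f | ∃ a b, f = e1 a b} ∪ {f | ∃ jk a i, f = e2 jk a i}, fun t => ?_⟩
  have hval1 : ∀ v : ι → ℂ, e1.map (MvPolynomial.eval₂Hom (evalRingHom t) v) =
      (of fun a i => v (Sum.inl (a, i))) * (of fun i a => v (Sum.inr (Sum.inl (i, a)))) - 1 := by
    intro v
    rw [Matrix.map_sub _ (map_sub _), Matrix.map_mul, Matrix.map_one _ (map_zero _) (map_one _)]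
    congr 2 <;> ext <;> exact MvPolynomial.eval₂Hom_X' _ _ _
  have hval2 : ∀ (v : ι → ℂ) jk, (e2 jk).map (MvPolynomial.eval₂Hom (evalRingHom t) v) =
      cols ((of fun a i => v (Sum.inl (a, i))) * (G jk.1).map (eval t)) jk.2 -
      (of fun a c => v (Sum.inr (Sum.inr (Sum.inl ⟨jk, (a, c)⟩)))) *
      (of fun c i => v (Sum.inr (Sum.inr (Sum.inr ⟨jk, (c, i)⟩)))) := by
    intro v jk
    rw [Matrix.map_sub _ (map_sub _), Matrix.map_mul, Matrix.map_mul, cols_mul]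
    congr 2
    · ext; exact MvPolynomial.eval₂Hom_X' _ _ _
    · ext; exact MvPolynomial.eval₂Hom_C _ _ _
    · ext; exact MvPolynomial.eval₂Hom_X' _ _ _
    · ext; exact MvPolynomial.eval₂Hom_X' _ _ _
  constructor
  · rintro ⟨Q0, hQ0, hr⟩
    choose x0 y0 hxy using fun jk : Fin 3 × Fin n => exists_rank_factorization _ (hr jk.1 jk.2)
    let v : ι → ℂ := Sum.elim (fun p => Q0 p.1 p.2) (Sum.elim (fun p => Q0ᴴ p.1 p.2)
      (Sum.elim (fun s => x0 s.1 s.2.1 s.2.2) (fun s => y0 s.1 s.2.1 s.2.2)))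
    refine ⟨v, ?_⟩
    rintro f (⟨a, b, rfl⟩ | ⟨jk, a, i, rfl⟩)
    · have h1 := hval1 v
      rw [show (of fun a i => v (Sum.inl (a, i))) = Q0 from rfl,
        show (of fun i a => v (Sum.inr (Sum.inl (i, a)))) = Q0ᴴ from rfl, hQ0, sub_self] at h1
      exact congrFun (congrFun h1 a) b
    · have h1 := hval2 v jk
      rw [show (of fun a i => v (Sum.inl (a, i))) = Q0 from rfl,
        show (of fun a c => v (Sum.inr (Sum.inr (Sum.inl ⟨jk, (a, c)⟩)))) = x0 jk from rfl,
        show (of fun c i => v (Sum.inr (Sum.inr (Sum.inr ⟨jk, (c, i)⟩)))) = y0 jk from rfl,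
        hxy jk, sub_self] at h1
      exact congrFun (congrFun h1 a) i
  · rintro ⟨v, hv⟩
    have h1 : e1.map (MvPolynomial.eval₂Hom (evalRingHom t) v) = 0 := by
      ext a b
      exact hv _ (Or.inl ⟨a, b, rfl⟩)
    have h2 : ∀ jk, (e2 jk).map (MvPolynomial.eval₂Hom (evalRingHom t) v) = 0 := by
      intro jk
      ext a i
      exact hv _ (Or.inr ⟨jk, a, i, rfl⟩)
    rw [hval1, sub_eq_zero] at h1
    obtain ⟨P, hP⟩ := exists_mul_orthonormal_rows h1
    refine ⟨_, hP, fun j k => ?_⟩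
    have h3 := h2 (j, k)
    rw [hval2, sub_eq_zero] at h3
    rw [Matrix.mul_assoc, cols_mul, h3, ← Matrix.mul_assoc]
    exact (rank_mul_le_left _ _).trans ((rank_le_card_width _).trans_eq (Fintype.card_fin _))

lemma isCompact_setOf_mul_conjTranspose_eq_one (m n : ℕ) :
    IsCompact {Q : Matrix (Fin m) (Fin n) ℂ | Q * Qᴴ = 1} := by
  have hsub : {Q : Matrix (Fin m) (Fin n) ℂ | Q * Qᴴ = 1} ⊆
      Set.pi Set.univ fun _ : Fin m => Set.pi Set.univ fun _ : Fin n => Metric.closedBall 0 1 := by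
    intro Q hQ a _ i _
    have h1 := congrFun (congrFun hQ a) a
    rw [Matrix.mul_apply, one_apply_eq] at h1
    have h2 : ∑ i, Complex.normSq (Q a i) = 1 := by
      have := congrArg Complex.re h1
      simpa [conjTranspose_apply, Complex.mul_conj] using this
    have h3 : Complex.normSq (Q a i) ≤ 1 := h2 ▸ Finset.single_le_sum
      (f := fun i => Complex.normSq (Q a i)) (fun i _ => Complex.normSq_nonneg _)
      (Finset.mem_univ i)
    rw [mem_closedBall_zero_iff]
    rw [Complex.normSq_eq_norm_sq] at h3
    nlinarith [norm_nonneg (Q a i)]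
  refine IsCompact.of_isClosed_subset (isCompact_univ_pi fun _ => isCompact_univ_pi fun _ =>
    isCompact_closedBall 0 1) ?_ hsub
  exact isClosed_eq (by fun_prop) continuous_const

lemma isClosed_setOf_rankBounded {n : ℕ} (G : Fin 3 → Matrix (Fin n) (Fin n) (Polynomial ℂ))
    (m : ℕ) (r : Fin 3 → Fin n → ℕ) : IsClosed {t | RankBounded G m r t} := by
  have : CompactSpace {Q : Matrix (Fin m) (Fin n) ℂ // Q * Qᴴ = 1} :=
    isCompact_iff_compactSpace.mp (isCompact_setOf_mul_conjTranspose_eq_one m n)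
  let F : Set ({Q : Matrix (Fin m) (Fin n) ℂ // Q * Qᴴ = 1} × ℂ) :=
    ⋂ j, ⋂ k, {x | (cols (x.1.1 * (G j).map (Polynomial.eval x.2)) k).rank ≤ r j k}
  have hF : IsClosed F := by
    refine isClosed_iInter fun j => isClosed_iInter fun k => ?_
    refine (isClosed_setOf_rank_le (Fin m) {i : Fin n // i ≤ k} (r j k)).preimage ?_
    have h1 : Continuous fun x : {Q : Matrix (Fin m) (Fin n) ℂ // Q * Qᴴ = 1} × ℂ =>
        (G j).map (Polynomial.eval x.2) :=
      continuous_matrix fun a b => (G j a b).continuous.comp continuous_snd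
    have h2 : Continuous fun x : {Q : Matrix (Fin m) (Fin n) ℂ // Q * Qᴴ = 1} × ℂ => x.1.1 :=
      continuous_subtype_val.comp continuous_fst
    exact (h2.matrix_mul h1).matrix_submatrix _ _
  convert isClosedMap_snd_of_compactSpace F hF using 1
  ext t
  constructor
  · rintro ⟨Q, hQ, hr⟩
    exact ⟨(⟨Q, hQ⟩, t), Set.mem_iInter₂.mpr hr, rfl⟩
  · rintro ⟨⟨Q, t'⟩, hQ, rfl⟩
    exact ⟨Q.1, Q.2, Set.mem_iInter₂.mp hQ⟩

lemma rankBounded_of_infinite {n : ℕ} {G : Fin 3 → Matrix (Fin n) (Fin n) (Polynomial ℂ)}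
    {m : ℕ} {r : Fin 3 → Fin n → ℕ} (h : {t | RankBounded G m r t}.Infinite) (t : ℂ) :
    RankBounded G m r t := by
  obtain ⟨ι, _, S, hS⟩ := exists_polynomial_system_rankBounded G m r
  have h1 : {t | RankBounded G m r t}ᶜ.Finite := by
    have := finite_compl_of_infinite_zeros S (by simpa only [← hS] using h)
    simp only [← hS] at this
    exact this
  have h2 : Dense {t | RankBounded G m r t} := by
    have := h1.countable.dense_compl ℂ
    rwa [compl_compl] at this
  have h3 := (isClosed_setOf_rankBounded G m r).closure_eq
  rw [h2.closure_eq] at h3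
  have h4 : t ∈ {t | RankBounded G m r t} := h3 ▸ Set.mem_univ t
  exact h4

open scoped ComplexOrder in
lemma rank_of_mul_conjTranspose_eq_one {m n : ℕ} {Q : Matrix (Fin m) (Fin n) ℂ}
    (hQ : Q * Qᴴ = 1) : Q.rank = m := by
  have h := rank_self_mul_conjTranspose Q
  rw [hQ, rank_one, Fintype.card_fin] at h
  exact h.symm

lemma rank_cols_last {m n : ℕ} (M : Matrix (Fin m) (Fin n) ℂ) {k : Fin n}
    (hk : ¬ k.val + 1 < n) : (cols M k).rank = M.rank :=
  rank_submatrix M (Equiv.refl _) (Equiv.subtypeUnivEquiv (p := fun i => i ≤ k)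
    fun i => Fin.le_def.mpr (by omega))

/-- Semistability of a polynomial family is a generic condition. -/
lemma exists_semistable_of_infinite {n : ℕ} {lam : Fin 3 → Fin n → ℝ}
    (hanti : ∀ j, Antitone (lam j)) {G : Fin 3 → Matrix (Fin n) (Fin n) (Polynomial ℂ)} {t₀ : ℂ}
    (hss : Semistable lam fun j => (G j).map (Polynomial.eval t₀))
    (hdet₀ : ∀ j, ((G j).map (Polynomial.eval t₀)).det ≠ 0)
    {T : Set ℂ} (hT : T.Infinite) (hdet : ∀ t ∈ T, ∀ j, ((G j).map (Polynomial.eval t)).det ≠ 0) :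
    ∃ t ∈ T, Semistable lam fun j => (G j).map (Polynomial.eval t) := by
  by_contra! hbad
  simp only [Semistable, not_forall, not_le, exists_prop] at hbad
  choose! m Q hQ hneg using hbad
  have hmn : ∀ t ∈ T, m t < n + 1 := fun t ht => by
    have h := rank_le_width (Q t)
    rw [rank_of_mul_conjTranspose_eq_one (hQ t ht)] at h
    exact Nat.lt_succ_of_le h
  have hr : ∀ t ∈ T, ∀ j k, (cols (Q t * (G j).map (Polynomial.eval t)) k).rank < n + 1 :=
    fun t ht j k => (rank_le_card_height _).trans_lt (by simpa using hmn t ht)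
  have : Infinite T := hT.to_subtype
  obtain ⟨⟨m₀, r₀⟩, hfib⟩ := Finite.exists_infinite_fiber
    fun t : T => ((⟨m t, hmn t t.2⟩ : Fin (n + 1)),
      (fun j k => ⟨_, hr t t.2 j k⟩ : Fin 3 → Fin n → Fin (n + 1)))
  have hinf := (Set.infinite_coe_iff.mp hfib).image (f := Subtype.val) Subtype.val_injective.injOn
  obtain ⟨_, t₁, ht₁, rfl⟩ := hinf.nonempty
  have key : ∀ t : T, ((⟨m t, hmn t t.2⟩ : Fin (n + 1)),
      (fun j k => ⟨_, hr t t.2 j k⟩ : Fin 3 → Fin n → Fin (n + 1))) = (m₀, r₀) →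
      m t = m₀ ∧ ∀ j k, (cols (Q t * (G j).map (Polynomial.eval (t : ℂ))) k).rank = r₀ j k := by
    intro t ht
    simp only [Prod.mk.injEq] at ht
    exact ⟨congrArg Fin.val ht.1, fun j k => congrArg Fin.val (congrFun (congrFun ht.2 j) k)⟩
  have hbd : {t | RankBounded G m₀ (fun j k => r₀ j k) t}.Infinite := by
    refine hinf.mono ?_
    rintro _ ⟨t, ht, rfl⟩
    obtain ⟨h1, h2⟩ := key t ht
    have : RankBounded G (m t) (fun j k => r₀ j k) (t : ℂ) :=
      ⟨Q t, hQ t t.2, fun j k => (h2 j k).le⟩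
    rwa [h1] at this
  obtain ⟨Q₀, hQ₀, hle⟩ := rankBounded_of_infinite hbd t₀
  obtain ⟨h1, h2⟩ := key t₁ ht₁
  have hneg₁ := hneg t₁ t₁.2
  refine hneg₁.not_ge ((hss m₀ Q₀ hQ₀).trans (Finset.sum_le_sum fun j _ =>
    Finset.sum_le_sum fun k _ => ?_))
  by_cases hk : k.val + 1 < n
  · exact mul_le_mul_of_nonneg_left (by rw [h2]; exact_mod_cast hle j k) (gap_nonneg (hanti j) hk)
  · refine le_of_eq ?_
    rw [rank_cols_last _ hk, rank_cols_last _ hk,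
      rank_mul_eq_left_of_isUnit_det _ _ (hdet₀ j).isUnit,
      rank_mul_eq_left_of_isUnit_det _ _ (hdet t₁ t₁.2 j).isUnit,
      rank_of_mul_conjTranspose_eq_one hQ₀, rank_of_mul_conjTranspose_eq_one (hQ t₁ t₁.2), h1]

/-- The Cayley transform of a `J`-skew matrix preserves the form defined by `J`. -/
lemma cayley_conjTranspose_mul {n : ℕ} {J X W : Matrix (Fin n) (Fin n) ℂ}
    (hX : Xᴴ * J = -(J * X)) (hW : (1 - X) * W = 1) :
    ((1 + X) * W)ᴴ * J * ((1 + X) * W) = J := by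
  have h1 : (1 - X)ᴴ * J = J * (1 + X) := by
    rw [conjTranspose_sub, conjTranspose_one, Matrix.sub_mul, hX]; noncomm_ring
  have h2 : (1 + X)ᴴ * J = J * (1 - X) := by
    rw [conjTranspose_add, conjTranspose_one, Matrix.add_mul, hX]; noncomm_ring
  have h3 : (1 - X) * (1 + X) = (1 + X) * (1 - X) := by noncomm_ring
  calc ((1 + X) * W)ᴴ * J * ((1 + X) * W)
      = Wᴴ * ((1 + X)ᴴ * J) * (1 + X) * W := by
        rw [conjTranspose_mul]; simp only [Matrix.mul_assoc]
    _ = Wᴴ * J * ((1 - X) * (1 + X)) * W := by rw [h2]; simp only [Matrix.mul_assoc]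
    _ = Wᴴ * (J * (1 + X)) * ((1 - X) * W) := by rw [h3]; simp only [Matrix.mul_assoc]
    _ = ((1 - X) * W)ᴴ * J := by
        rw [← h1, hW, Matrix.mul_one, ← Matrix.mul_assoc, ← conjTranspose_mul, hW]
    _ = J := by rw [hW, conjTranspose_one, Matrix.one_mul]

lemma exists_skew_decomposition {n : ℕ} {J : Matrix (Fin n) (Fin n) ℂ} (hJ : Jᴴ = J)
    (hJJ : J * J = 1) (X : Matrix (Fin n) (Fin n) ℂ) :
    ∃ Y Z : Matrix (Fin n) (Fin n) ℂ, Y + Complex.I • Z = X ∧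
      ∀ t : ℝ, (Y + (t : ℂ) • Z)ᴴ * J = -(J * (Y + (t : ℂ) • Z)) := by
  set K := J * Xᴴ * J with hK
  have h1 : Xᴴ * J = J * K := by
    rw [hK, ← Matrix.mul_assoc, ← Matrix.mul_assoc, hJJ, Matrix.one_mul]
  have h2 : Kᴴ * J = J * X := by
    rw [hK, conjTranspose_mul, conjTranspose_mul, conjTranspose_conjTranspose, hJ,
      Matrix.mul_assoc, Matrix.mul_assoc, hJJ, Matrix.mul_one]
  refine ⟨(1 / 2 : ℂ) • (X - K), (-Complex.I / 2) • (X + K), ?_, fun t => ?_⟩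
  · rw [smul_smul, show Complex.I * (-Complex.I / 2) = 1 / 2 by
      rw [mul_div_assoc', mul_neg, Complex.I_mul_I, neg_neg], ← smul_add,
      sub_add_add_cancel, ← two_smul ℂ X, smul_smul]
    norm_num
  · have hc : star ((t : ℂ) * (-Complex.I / 2)) = -((t : ℂ) * (-Complex.I / 2)) := by
      simp [Complex.conj_ofReal]
      ring
    have hh : star (1 / 2 : ℂ) = 1 / 2 := by simp
    rw [smul_smul, conjTranspose_add, conjTranspose_smul, conjTranspose_smul, hc, hh,
      conjTranspose_sub, conjTranspose_add, Matrix.add_mul, Matrix.smul_mul, Matrix.smul_mul,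
      Matrix.sub_mul, Matrix.add_mul, h1, h2, Matrix.mul_add, Matrix.mul_smul, Matrix.mul_smul,
      Matrix.mul_sub, Matrix.mul_add]
    module

open scoped ComplexOrder in
lemma exists_cayley {n : ℕ} {u : Matrix (Fin n) (Fin n) ℂ} (hu : uᴴ * u = 1) :
    ∃ X : Matrix (Fin n) (Fin n) ℂ, (1 - X).det ≠ 0 ∧ 1 + X = (2 : ℂ) • u * (1 - X) := by
  have hpos : ((1 + 2 • u : Matrix (Fin n) (Fin n) ℂ)ᴴ * (1 + 2 • u)).PosDef := by
    have : (1 + 2 • u : Matrix (Fin n) (Fin n) ℂ)ᴴ * (1 + 2 • u) = 1 + (((1 + u)ᴴ * (1 + u)) + ((1 + u)ᴴ * (1 + u))) := by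
      simp only [conjTranspose_add, conjTranspose_one, conjTranspose_nsmul]
      simp only [Matrix.add_mul, Matrix.mul_add, Matrix.one_mul, Matrix.mul_one, Matrix.smul_mul, Matrix.mul_smul, hu]
      module
    rw [this]
    exact PosDef.one.add_posSemidef ((posSemidef_conjTranspose_mul_self _).add
      (posSemidef_conjTranspose_mul_self _))
  have hunit : IsUnit (1 + 2 • u).det := by
    have := hpos.det_pos.ne'
    rw [det_mul] at this
    exact (right_ne_zero_of_mul this).isUnit
  set W := (1 + 2 • u)⁻¹ with hW
  have hW1 : (1 + 2 • u) * W = 1 := mul_nonsing_inv _ hunit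
  have h1 : 1 - (2 • u - 1) * W = 2 • W := by
    calc 1 - (2 • u - 1) * W = (1 + 2 • u) * W - (2 • u - 1) * W := by rw [hW1]
      _ = 2 • W := by noncomm_ring
  refine ⟨(2 • u - 1) * W, ?_, ?_⟩
  · intro h0
    rw [h1] at h0
    have h2 : (1 + 2 • u).det * (2 • W).det = (2 • (1 : Matrix (Fin n) (Fin n) ℂ)).det := by
      rw [← det_mul, Matrix.mul_smul, hW1]
    rw [h0, mul_zero, ← Nat.cast_smul_eq_nsmul ℂ, det_smul, det_one] at h2
    simp at h2
    exact pow_ne_zero n two_ne_zero h2.symm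
  · calc 1 + (2 • u - 1) * W = (1 + 2 • u) * W + (2 • u - 1) * W := by rw [hW1]
      _ = 2 • u * (2 • W) := by noncomm_ring
      _ = (2 : ℂ) • u * (1 - (2 • u - 1) * W) := by
        rw [h1, ← Nat.cast_smul_eq_nsmul ℂ 2 u, Nat.cast_ofNat]

lemma det_ne_zero_of_conjTranspose_mul_mul_eq {n : ℕ} {J g : Matrix (Fin n) (Fin n) ℂ}
    (hJJ : J * J = 1) (hg : gᴴ * J * g = J) : g.det ≠ 0 := by
  intro h0
  have h1 := congrArg det hg
  rw [det_mul, h0, mul_zero] at h1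
  have h2 := congrArg det hJJ
  rw [det_mul, ← h1, mul_zero, det_one] at h2
  exact zero_ne_one h2

lemma exists_semistable_of_sum_conjDiag_eq_zero {n : ℕ} {J : Matrix (Fin n) (Fin n) ℂ}
    (hJ : Jᴴ = J) (hJJ : J * J = 1) {lam : Fin 3 → Fin n → ℝ} (hanti : ∀ j, Antitone (lam j))
    {u : Fin 3 → Matrix (Fin n) (Fin n) ℂ} (hu : ∀ j, (u j)ᴴ * u j = 1)
    (hsum : ∑ j, conjDiag (u j) (lam j) = 0) :
    ∃ g : Fin 3 → Matrix (Fin n) (Fin n) ℂ, (∀ j, (g j)ᴴ * J * g j = J) ∧ Semistable lam g := by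
  choose X hX hXu using fun j => exists_cayley (hu j)
  choose Y Z hYZ hskew using fun j => exists_skew_decomposition hJ hJJ (X j)
  let P : Fin 3 → Matrix (Fin n) (Fin n) (Polynomial ℂ) := fun j =>
    (Y j).map Polynomial.C + (Polynomial.X : Polynomial ℂ) • (Z j).map Polynomial.C
  let G : Fin 3 → Matrix (Fin n) (Fin n) (Polynomial ℂ) := fun j => (1 + P j) * adjugate (1 - P j)
  let x : Fin 3 → ℂ → Matrix (Fin n) (Fin n) ℂ := fun j t => Y j + t • Z j
  have hP : ∀ j t, (Polynomial.evalRingHom t).mapMatrix (P j) = x j t := by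
    intro j t
    ext a b
    simp [P, x]
    ring
  have hD : ∀ j t, (1 - P j).det.eval t = (1 - x j t).det := by
    intro j t
    rw [← hP, ← map_one (Polynomial.evalRingHom t).mapMatrix, ← map_sub, ← RingHom.map_det]
    rfl
  have hG : ∀ j t, (G j).map (Polynomial.eval t) = (1 + x j t) * adjugate (1 - x j t) := by
    intro j t
    rw [← hP, ← map_one (Polynomial.evalRingHom t).mapMatrix, ← map_sub, ← map_add,
      ← RingHom.map_adjugate, ← map_mul]
    rfl
  have hxI : ∀ j, x j Complex.I = X j := fun j => hYZ j
  have hGI : ∀ j, (G j).map (Polynomial.eval Complex.I) = (2 * (1 - X j).det) • u j := by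
    intro j
    rw [hG, hxI, hXu, Matrix.mul_assoc, mul_adjugate, Matrix.mul_smul, Matrix.mul_one, smul_smul,
      mul_comm]
  have hne : ∀ j, 2 * (1 - X j).det ≠ 0 := fun j => mul_ne_zero two_ne_zero (hX j)
  have hJg : ∀ j (t : ℝ), (1 - x j t).det ≠ 0 →
      ((1 - x j t).det⁻¹ • (G j).map (Polynomial.eval (t : ℂ)))ᴴ * J *
        ((1 - x j t).det⁻¹ • (G j).map (Polynomial.eval (t : ℂ))) = J := by
    intro j t h
    rw [hG, ← Matrix.mul_smul]
    refine cayley_conjTranspose_mul (hskew j t) ?_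
    rw [Matrix.mul_smul, mul_adjugate, smul_smul, inv_mul_cancel₀ h, one_smul]
  have hD0 : ∀ j, (1 - P j).det ≠ 0 := by
    intro j h0
    apply hX j
    rw [← hxI, ← hD, h0, Polynomial.eval_zero]
  have hT : (Set.range ((↑) : ℝ → ℂ) \ ⋃ j, {t | (1 - P j).det.IsRoot t}).Infinite :=
    (Set.infinite_range_of_injective Complex.ofReal_injective).sdiff
      (Set.finite_iUnion fun j => Polynomial.finite_setOfPred_isRoot (hD0 j))
  obtain ⟨_, ⟨⟨t, rfl⟩, ht⟩, hss⟩ := exists_semistable_of_infinite hanti (G := G)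
    (t₀ := Complex.I) (by
      simp only [hGI]
      exact (semistable_of_sum_conjDiag_eq_zero hanti hu hsum).smul hne) (by
      intro j
      rw [hGI, det_smul]
      refine mul_ne_zero (pow_ne_zero _ (hne j)) fun h0 => ?_
      have := congrArg det (hu j)
      rw [det_mul, h0, mul_zero, det_one] at this
      exact zero_ne_one this) hT (by
      rintro _ ⟨⟨t, rfl⟩, ht⟩ j
      have h1 : (1 - x j t).det ≠ 0 := fun h0 =>
        ht (Set.mem_iUnion.mpr ⟨j, (hD j t).trans h0⟩)
      have h2 := det_ne_zero_of_conjTranspose_mul_mul_eq hJJ (hJg j t h1)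
      rw [det_smul] at h2
      exact right_ne_zero_of_mul h2)
  have h1 : ∀ j, (1 - x j t).det ≠ 0 := fun j h0 =>
    ht (Set.mem_iUnion.mpr ⟨j, (hD j t).trans h0⟩)
  exact ⟨_, fun j => hJg j t (h1 j), hss.smul fun j => inv_ne_zero (h1 j)⟩

open Submodule in
lemma exists_minor_ne_zero {n : ℕ} {ι : Type*} [Fintype ι] [DecidableEq ι]
    (N : Matrix (Fin n) ι ℂ) (hN : N.rank = Fintype.card ι) :
    ∃ e : ι → Fin n, Function.Injective e ∧ (N.submatrix e id).det ≠ 0 ∧ ∀ m : Fin n,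
      Nat.card {a // e a ≤ m} = (N.submatrix (Fin.castLE (Nat.succ_le_of_lt m.isLt)) id).rank := by
  let S : ℕ → Set (Fin n) := fun l => {i | i.val < l}
  let I : Set (Fin n) := {i | N.row i ∉ span ℂ (N.row '' S i)}
  have hS : ∀ l (hl : l < n), S (l + 1) = insert ⟨l, hl⟩ (S l) := by
    intro l hl
    ext i
    change i.val < l + 1 ↔ i = ⟨l, hl⟩ ∨ i.val < l
    rw [Fin.ext_iff]
    change i.val < l + 1 ↔ i.val = l ∨ i.val < l
    omega
  have hI : ∀ l ≤ n, LinearIndepOn ℂ N.row (I ∩ S l) ∧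
      span ℂ (N.row '' (I ∩ S l)) = span ℂ (N.row '' S l) := by
    intro l
    induction l with
    | zero =>
      intro _
      have : S 0 = ∅ := Set.eq_empty_of_forall_notMem fun i => Nat.not_lt_zero _
      rw [this, Set.inter_empty]
      exact ⟨linearIndepOn_empty _ _, rfl⟩
    | succ l ih =>
      intro hl
      obtain ⟨ih1, ih2⟩ := ih (by omega)
      rw [hS l hl]
      by_cases hmem : (⟨l, hl⟩ : Fin n) ∈ I
      · rw [Set.inter_insert_of_mem hmem]
        refine ⟨ih1.insert ?_, ?_⟩
        · rw [ih2]; exact hmem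
        · rw [Set.image_insert_eq, Set.image_insert_eq, span_insert, span_insert, ih2]
      · rw [Set.inter_insert_of_notMem hmem]
        refine ⟨ih1, ?_⟩
        rw [ih2, Set.image_insert_eq, span_insert, right_eq_sup, span_singleton_le_iff_mem]
        exact not_not.mp hmem
  have hcard : ∀ l (hl : l ≤ n), Nat.card ↥(I ∩ S l) =
      (N.submatrix (Fin.castLE hl) id).rank := by
    intro l hl
    classical
    obtain ⟨h1, h2⟩ := hI l hl
    have h3 := finrank_span_eq_card h1
    rw [← Set.image_eq_range, h2] at h3
    rw [Nat.card_eq_fintype_card, ← h3, rank_eq_finrank_span_row]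
    have h4 : N.row '' S l = Set.range (N.submatrix (Fin.castLE hl) id).row := by
      ext x
      constructor
      · rintro ⟨i, hi, rfl⟩
        exact ⟨⟨i, hi⟩, rfl⟩
      · rintro ⟨i, rfl⟩
        exact ⟨_, i.isLt, rfl⟩
    rw [h4]
  have hall : I ∩ S n = I := Set.inter_eq_left.mpr fun i _ => i.isLt
  have hcardI : Nat.card I = Nat.card ι := by
    rw [Nat.card_eq_fintype_card (α := ι), ← hN, ← hall]
    exact hcard n le_rfl
  obtain ⟨e⟩ := Finite.card_eq.mp hcardI
  refine ⟨fun a => e.symm a, Subtype.val_injective.comp e.symm.injective, ?_, fun m => ?_⟩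
  · have h1 := (hI n le_rfl).1
    rw [hall] at h1
    have h2 : LinearIndependent ℂ (N.submatrix (fun a => (e.symm a : Fin n)) id).row :=
      h1.comp _ e.symm.injective
    exact ((isUnit_iff_isUnit_det _).mp (linearIndependent_rows_iff_isUnit.mp h2)).ne_zero
  · rw [← hcard]
    refine Nat.card_congr ((e.symm.subtypeEquiv (q := fun i => i.val ≤ m) fun a => Iff.rfl).trans
      ⟨fun i => ⟨i.1.1, i.1.2, Nat.lt_succ_of_le (Fin.le_def.mp i.2)⟩,
        fun i => ⟨⟨i.1, i.2.1⟩, Fin.le_def.mpr (Nat.le_of_lt_succ i.2.2)⟩, fun _ => rfl, fun _ => rfl⟩)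

open scoped ComplexOrder in
lemma one_le_re_det_one_add {ι : Type*} [Fintype ι] [DecidableEq ι] {P : Matrix ι ι ℂ}
    (hP : P.PosSemidef) : 1 ≤ (1 + P).det.re := by
  have hA : (1 + P).IsHermitian := isHermitian_one.add hP.1
  have h1 : ∀ i, 1 ≤ hA.eigenvalues i := by
    intro i
    have h1 := hP.re_dotProduct_nonneg (hA.eigenvectorBasis i)
    have h2 := hA.eigenvalues_eq i
    have h3 : star (hA.eigenvectorBasis i : ι → ℂ) ⬝ᵥ (hA.eigenvectorBasis i : ι → ℂ) = 1 := by
      have := hA.eigenvectorBasis.inner_eq_one i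
      rwa [EuclideanSpace.inner_eq_star_dotProduct, dotProduct_comm] at this
    rw [add_mulVec, one_mulVec, dotProduct_add, map_add, h3] at h2
    rw [h2]
    simpa using h1
  rw [hA.det_eq_prod_eigenvalues, ← RCLike.ofReal_prod]
  change 1 ≤ ∏ i, hA.eigenvalues i
  calc (1 : ℝ) = ∏ _i : ι, 1 := Finset.prod_const_one.symm
    _ ≤ _ := Finset.prod_le_prod (fun _ _ => zero_le_one) fun i _ => h1 i

open scoped ComplexOrder in
lemma normSq_det_le_re_det_add {ι : Type*} [Fintype ι] [DecidableEq ι] {R P : Matrix ι ι ℂ}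
    (hP : P.PosSemidef) : Complex.normSq R.det ≤ (Rᴴ * R + P).det.re := by
  by_cases hR : R.det = 0
  · rw [hR, map_zero]
    exact (Complex.nonneg_iff.mp ((posSemidef_conjTranspose_mul_self R).add hP).det_nonneg).1
  · have hR' : IsUnit R.det := Ne.isUnit hR
    have h1 : Rᴴ * R + P = Rᴴ * (1 + (R⁻¹)ᴴ * P * R⁻¹) * R := by
      rw [Matrix.mul_add, Matrix.mul_one, Matrix.add_mul]
      congr 1
      calc P = (R⁻¹ * R)ᴴ * P * (R⁻¹ * R) := by rw [nonsing_inv_mul _ hR']; simp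
        _ = _ := by rw [conjTranspose_mul]; simp only [Matrix.mul_assoc]
    rw [h1, det_mul, det_mul, det_conjTranspose, mul_right_comm, mul_comm (star _)]
    change _ ≤ (R.det * (starRingEnd ℂ) R.det * _).re
    rw [Complex.mul_conj, Complex.re_ofReal_mul]
    exact le_mul_of_one_le_right (Complex.normSq_nonneg _)
      (one_le_re_det_one_add (hP.conjTranspose_mul_mul_same _))

lemma conjTranspose_mul_diagonal_mul_apply {m ι : Type*} [Fintype m] [DecidableEq m]
    (N : Matrix m ι ℂ) (d : m → ℝ) (a b : ι) :
    (Nᴴ * diagonal (fun i => (d i : ℂ)) * N) a b = ∑ i, star (N i a) * d i * N i b := by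
  rw [Matrix.mul_apply]
  simp only [mul_diagonal, conjTranspose_apply]

lemma conjTranspose_mul_diagonal_mul_eq {n : ℕ} {ι : Type*} [Fintype ι] [DecidableEq ι]
    {e : ι → Fin n} (he : Function.Injective e) (N : Matrix (Fin n) ι ℂ) (d : Fin n → ℝ) :
    Nᴴ * diagonal (fun i => (d i : ℂ)) * N =
      (N.submatrix e id)ᴴ * diagonal (fun a => (d (e a) : ℂ)) * N.submatrix e id +
      (N.submatrix (Subtype.val : {i // i ∉ Set.range e} → Fin n) id)ᴴ *
        diagonal (fun i : {i // i ∉ Set.range e} => (d i.1 : ℂ)) *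
        N.submatrix (Subtype.val : {i // i ∉ Set.range e} → Fin n) id := by
  ext a b
  rw [Matrix.add_apply, conjTranspose_mul_diagonal_mul_apply,
    conjTranspose_mul_diagonal_mul_apply _ (fun a => d (e a)),
    conjTranspose_mul_diagonal_mul_apply _ (fun i : {i // i ∉ Set.range e} => d i.1),
    ← Fintype.sum_subtype_add_sum_subtype (fun i => i ∈ Set.range e)]
  congr 1
  convert! ((Equiv.ofInjective e he).sum_comp fun i : Set.range e => star (N i a) * d i * N i b).symm

lemma re_det_conjTranspose_mul_diagonal_mul {ι : Type*} [Fintype ι] [DecidableEq ι]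
    (M : Matrix ι ι ℂ) (d : ι → ℝ) :
    (Mᴴ * diagonal (fun a => (d a : ℂ)) * M).det.re = (∏ a, d a) * Complex.normSq M.det := by
  rw [det_mul, det_mul, det_conjTranspose, det_diagonal, mul_right_comm, mul_comm (star _)]
  change (M.det * (starRingEnd ℂ) M.det * _).re = _
  rw [Complex.mul_conj, Complex.re_ofReal_mul, ← Complex.ofReal_prod, Complex.ofReal_re, mul_comm]

lemma re_det_conjTranspose_mul_diagonal_mul_of_bijective {n : ℕ} {ι : Type*} [Fintype ι]
    [DecidableEq ι] {e : ι → Fin n} (he : Function.Bijective e) (N : Matrix (Fin n) ι ℂ)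
    (d : Fin n → ℝ) :
    (Nᴴ * diagonal (fun i => (d i : ℂ)) * N).det.re =
      (∏ a, d (e a)) * Complex.normSq (N.submatrix e id).det := by
  rw [← re_det_conjTranspose_mul_diagonal_mul, conjTranspose_mul_diagonal_mul_eq he.1]
  congr 2
  rw [add_eq_left]
  ext a b
  rw [conjTranspose_mul_diagonal_mul_apply _ (fun i : {i // i ∉ Set.range e} => d i.1)]
  exact Finset.sum_eq_zero fun i _ => absurd (he.2 i.1) i.2

open scoped ComplexOrder in
lemma prod_mul_normSq_le_re_det {n : ℕ} {ι : Type*} [Fintype ι] [DecidableEq ι]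
    {e : ι → Fin n} (he : Function.Injective e) (N : Matrix (Fin n) ι ℂ) {d : Fin n → ℝ}
    (hd : ∀ i, 0 ≤ d i) :
    (∏ a, d (e a)) * Complex.normSq (N.submatrix e id).det ≤
      (Nᴴ * diagonal (fun i => (d i : ℂ)) * N).det.re := by
  have hdiag : diagonal (fun a => (d (e a) : ℂ)) = (diagonal fun a => ((√(d (e a)) : ℝ) : ℂ))ᴴ *
      diagonal fun a => ((√(d (e a)) : ℝ) : ℂ) := by
    rw [diagonal_conjTranspose, diagonal_mul_diagonal]
    congr 1
    ext a
    simp only [Pi.star_apply, Complex.star_def, Complex.conj_ofReal]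
    rw [← Complex.ofReal_mul, Real.mul_self_sqrt (hd _)]
  have hR : (N.submatrix e id)ᴴ * diagonal (fun a => (d (e a) : ℂ)) * N.submatrix e id =
      ((diagonal fun a => ((√(d (e a)) : ℝ) : ℂ)) * N.submatrix e id)ᴴ *
      ((diagonal fun a => ((√(d (e a)) : ℝ) : ℂ)) * N.submatrix e id) := by
    rw [hdiag, conjTranspose_mul]
    simp only [Matrix.mul_assoc]
  rw [← re_det_conjTranspose_mul_diagonal_mul (N.submatrix e id) fun a => d (e a),
    conjTranspose_mul_diagonal_mul_eq he, hR]
  have hP : (diagonal (fun i : {i // i ∉ Set.range e} => (d i.1 : ℂ))).PosSemidef :=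
    PosSemidef.diagonal fun i => Complex.zero_le_real.mpr (hd _)
  refine le_trans (le_of_eq ?_) (normSq_det_le_re_det_add (hP.conjTranspose_mul_mul_same _))
  rw [det_mul, det_conjTranspose, mul_comm]
  change (_ * (starRingEnd ℂ) _).re = _
  rw [Complex.mul_conj, Complex.ofReal_re]

/-- The Gram determinant of the columns of `M` up to `k`. -/
noncomputable def gramDet {n : ℕ} (M : Matrix (Fin n) (Fin n) ℂ) (k : Fin n) : ℝ :=
  ((cols M k)ᴴ * cols M k).det.re

/-- The Kempf–Ness function of the triple of weighted flags, regularized by a multiple of the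
logarithm of the Frobenius norm. -/
noncomputable def energy {n : ℕ} (lam : Fin 3 → Fin n → ℝ) (g : Fin 3 → Matrix (Fin n) (Fin n) ℂ)
    (δ : ℝ) (h : Matrix (Fin n) (Fin n) ℂ) : ℝ :=
  ∑ j, ∑ k, gap (lam j) k * Real.log (gramDet (h * g j) k) + δ * Real.log (hᴴ * h).trace.re

lemma trace_conjDiag {n : ℕ} {U : Matrix (Fin n) (Fin n) ℂ} (hU : Uᴴ * U = 1) (d : Fin n → ℝ) :
    (conjDiag U d).trace = ((∑ i, d i : ℝ) : ℂ) := by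
  rw [conjDiag, trace_mul_comm, ← Matrix.mul_assoc, hU, Matrix.one_mul, trace_diagonal,
    Complex.ofReal_sum]

lemma conjDiag_mul {n : ℕ} {U : Matrix (Fin n) (Fin n) ℂ} (hU : Uᴴ * U = 1) (c d : Fin n → ℝ) :
    conjDiag U c * conjDiag U d = conjDiag U fun i => c i * d i := by
  have h1 : conjDiag U c * conjDiag U d = U * diagonal (fun i => (c i : ℂ)) * (Uᴴ * U) *
      diagonal (fun i => (d i : ℂ)) * Uᴴ := by
    simp only [conjDiag, Matrix.mul_assoc]
  rw [h1, hU, Matrix.mul_one, Matrix.mul_assoc U, diagonal_mul_diagonal]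
  simp only [conjDiag, Complex.ofReal_mul]

lemma conjDiag_one {n : ℕ} {U : Matrix (Fin n) (Fin n) ℂ} (hU : Uᴴ * U = 1) :
    conjDiag U (fun _ => 1) = 1 := by
  simp [conjDiag, mul_eq_one_comm.mp hU]

open scoped ComplexOrder in
lemma exists_polar {n : ℕ} {J h : Matrix (Fin n) (Fin n) ℂ} (hJJ : J * J = 1)
    (hh : hᴴ * J * h = J) :
    ∃ (U : Matrix (Fin n) (Fin n) ℂ) (s : Fin n → ℝ), Uᴴ * U = 1 ∧ Antitone s ∧
      hᴴ * h = conjDiag U (fun i => Real.exp (s i)) ∧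
      ∀ i, |s i| ≤ Real.log (hᴴ * h).trace.re := by
  have hH : (hᴴ * h).IsHermitian := isHermitian_conjTranspose_mul_self h
  have hdet : IsUnit h.det := (det_ne_zero_of_conjTranspose_mul_mul_eq hJJ hh).isUnit
  obtain ⟨U, hU, hHU⟩ := exists_conjDiag_eigsDesc hH
  set d := eigsDesc hH
  have hd : ∀ i, 0 < d i := by
    have h1 : Uᴴ * (hᴴ * h) * U = diagonal (fun i => (d i : ℂ)) := by
      rw [hHU, conjDiag]
      calc Uᴴ * (U * diagonal (fun i => (d i : ℂ)) * Uᴴ) * U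
          = (Uᴴ * U) * diagonal (fun i => (d i : ℂ)) * (Uᴴ * U) := by simp only [Matrix.mul_assoc]
        _ = _ := by rw [hU, Matrix.one_mul, Matrix.mul_one]
    have h2 : ((h * U)ᴴ * (h * U)).PosDef := by
      apply PosDef.conjTranspose_mul_self
      apply mulVec_injective_of_isUnit
      rw [isUnit_iff_isUnit_det, det_mul]
      exact hdet.mul ((isUnit_iff_isUnit_det _).mp (IsUnit.of_mul_eq_one _ (mul_eq_one_comm.mp hU)))
    rw [conjTranspose_mul, Matrix.mul_assoc, ← Matrix.mul_assoc hᴴ, ← Matrix.mul_assoc, h1,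
      posDef_diagonal_iff] at h2
    exact fun i => Complex.zero_lt_real.mp (h2 i)
  have htr : (hᴴ * h).trace.re = ∑ i, d i := by
    rw [hHU, trace_conjDiag hU, Complex.ofReal_re]
  have htr' : (hᴴ * h).trace.re = ∑ i, (d i)⁻¹ := by
    have h1 : hᴴ * h * conjDiag U (fun i => (d i)⁻¹) = 1 := by
      rw [hHU, conjDiag_mul hU, ← conjDiag_one hU]
      congr 1
      ext i
      exact mul_inv_cancel₀ (hd i).ne'
    have h2 : h * J * hᴴ = J := by
      have h3 : J * hᴴ * J * h = 1 := by
        rw [Matrix.mul_assoc J, Matrix.mul_assoc J, hh, hJJ]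
      have h4 := mul_eq_one_comm.mp h3
      calc h * J * hᴴ = h * (J * hᴴ * J) * J := by
            simp only [Matrix.mul_assoc, hJJ, Matrix.mul_one]
        _ = J := by rw [h4, Matrix.one_mul]
    have h3 : J * (hᴴ * h) * J * (hᴴ * h) = 1 := by
      calc J * (hᴴ * h) * J * (hᴴ * h) = J * (hᴴ * (h * J * hᴴ) * h) := by
            simp only [Matrix.mul_assoc]
        _ = 1 := by rw [h2, hh, hJJ]
    have h4 : conjDiag U (fun i => (d i)⁻¹) = J * (hᴴ * h) * J :=
      (left_inv_eq_right_inv h3 h1).symm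
    have h5 := congrArg trace h4
    rw [trace_conjDiag hU, trace_mul_comm, ← Matrix.mul_assoc, hJJ, Matrix.one_mul] at h5
    rw [← h5, Complex.ofReal_re]
  refine ⟨U, fun i => Real.log (d i), hU, fun i j hij =>
    Real.log_le_log (hd j) (eigsDesc_antitone hH hij), ?_, fun i => ?_⟩
  · rw [hHU]
    congr 1
    ext i
    rw [Real.exp_log (hd i)]
  · rw [abs_le']
    constructor
    · rw [htr]
      exact Real.log_le_log (hd i)
        (Finset.single_le_sum (f := d) (fun i _ => (hd i).le) (Finset.mem_univ i))
    · rw [← Real.log_inv, htr']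
      exact Real.log_le_log (inv_pos.mpr (hd i))
        (Finset.single_le_sum (f := fun i => (d i)⁻¹) (fun i _ => (inv_pos.mpr (hd i)).le)
          (Finset.mem_univ i))

lemma rank_cols_of_isUnit_det {n : ℕ} {M : Matrix (Fin n) (Fin n) ℂ} (hM : IsUnit M.det)
    (k : Fin n) : (cols M k).rank = Fintype.card {i : Fin n // i ≤ k} := by
  have h1 : LinearIndependent ℂ M.col :=
    linearIndependent_cols_iff_isUnit.mpr ((isUnit_iff_isUnit_det _).mpr hM)
  have h2 : LinearIndependent ℂ (cols M k)ᵀ.row := h1.comp _ Subtype.val_injective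
  rw [← rank_transpose, h2.rank_matrix]

lemma sum_minor_weight_nonneg {n : ℕ} {lam : Fin 3 → Fin n → ℝ}
    (hlam : ∑ j, ∑ i, lam j i = 0) {g : Fin 3 → Matrix (Fin n) (Fin n) ℂ}
    (hss : Semistable lam g) {V : Matrix (Fin n) (Fin n) ℂ} (hV : V * Vᴴ = 1)
    {s : Fin n → ℝ} (hs : Antitone s)
    {e : ∀ (_ : Fin 3) (k : Fin n), {i : Fin n // i ≤ k} → Fin n}
    (he : ∀ j k (m : Fin n), Nat.card {a // e j k a ≤ m} =
      ((cols (V * g j) k).submatrix (Fin.castLE (Nat.succ_le_of_lt m.isLt)) id).rank) :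
    0 ≤ ∑ j, ∑ k, gap (lam j) k * ∑ a, s (e j k a) := by
  have h1 : ∀ j k, ∑ a, s (e j k a) = ∑ m, gap s m * (Nat.card {a // e j k a ≤ m} : ℝ) := by
    intro j k
    simp_rw [← sum_gap s (e j k _)]
    rw [Finset.sum_comm]
    refine Finset.sum_congr rfl fun m _ => ?_
    rw [Nat.card_eq_fintype_card, Fintype.card_subtype, ← Finset.sum_filter, Finset.sum_const,
      nsmul_eq_mul, mul_comm]
  have h2 : ∑ j, ∑ k, gap (lam j) k * ∑ a, s (e j k a) =
      ∑ m, gap s m * ∑ j, ∑ k, gap (lam j) k * (Nat.card {a // e j k a ≤ m} : ℝ) := by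
    simp_rw [h1, Finset.mul_sum]
    rw [Finset.sum_comm (s := (Finset.univ : Finset (Fin n))) (t := (Finset.univ : Finset (Fin 3)))]
    refine Finset.sum_congr rfl fun j _ => ?_
    rw [Finset.sum_comm]
    exact Finset.sum_congr rfl fun _ _ => Finset.sum_congr rfl fun _ _ => mul_left_comm _ _ _
  rw [h2]
  refine Finset.sum_nonneg fun m _ => ?_
  by_cases hm : m.val + 1 < n
  · refine mul_nonneg (gap_nonneg hs hm) ?_
    simp only [he]
    refine hss _ (V.submatrix (Fin.castLE (Nat.succ_le_of_lt m.isLt)) id) ?_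
    have h3 : (V * Vᴴ).submatrix (Fin.castLE (Nat.succ_le_of_lt m.isLt))
        (Fin.castLE (Nat.succ_le_of_lt m.isLt)) = 1 := by
      rw [hV, submatrix_one _ (Fin.castLE_injective _)]
    exact h3
  · refine le_of_eq ?_
    have h3 : ∀ j k, (Nat.card {a // e j k a ≤ m} : ℝ) = ∑ i, if i ≤ k then 1 else 0 := by
      intro j k
      have : ∀ a, e j k a ≤ m := fun a => Fin.le_def.mpr (by omega)
      rw [Nat.card_congr (Equiv.subtypeUnivEquiv this), Nat.card_eq_fintype_card,
        Fintype.card_subtype, Finset.sum_boole]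
    simp only [h3, sum_gap_mul_sum (lam _) fun _ => 1, mul_one, hlam, mul_zero]

lemma gramDet_mul_eq {n : ℕ} {h U : Matrix (Fin n) (Fin n) ℂ} {d : Fin n → ℝ}
    (hh : hᴴ * h = conjDiag U d) (g : Matrix (Fin n) (Fin n) ℂ) (k : Fin n) :
    gramDet (h * g) k = ((cols (Uᴴ * g) k)ᴴ * diagonal (fun i => (d i : ℂ)) *
      cols (Uᴴ * g) k).det.re := by
  rw [gramDet, cols_mul, cols_mul, conjTranspose_mul, conjTranspose_mul, conjTranspose_conjTranspose,
    Matrix.mul_assoc, ← Matrix.mul_assoc hᴴ, hh, conjDiag]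
  simp only [Matrix.mul_assoc]

lemma gap_mul_le_gap_mul_log_gramDet {n : ℕ} {lam : Fin n → ℝ} (hanti : Antitone lam)
    {h U g : Matrix (Fin n) (Fin n) ℂ} {s : Fin n → ℝ}
    (hh : hᴴ * h = conjDiag U (fun i => Real.exp (s i))) {k : Fin n}
    {e : {i : Fin n // i ≤ k} → Fin n} (he : Function.Injective e)
    (hdet : ((cols (Uᴴ * g) k).submatrix e id).det ≠ 0) :
    gap lam k * (∑ a, s (e a) + Real.log (Complex.normSq ((cols (Uᴴ * g) k).submatrix e id).det)) ≤
      gap lam k * Real.log (gramDet (h * g) k) := by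
  have hpos : 0 < Complex.normSq ((cols (Uᴴ * g) k).submatrix e id).det :=
    Complex.normSq_pos.mpr hdet
  have hprod : 0 < ∏ a, Real.exp (s (e a)) := Finset.prod_pos fun _ _ => Real.exp_pos _
  have hlog : ∑ a, s (e a) + Real.log (Complex.normSq ((cols (Uᴴ * g) k).submatrix e id).det) =
      Real.log ((∏ a, Real.exp (s (e a))) *
        Complex.normSq ((cols (Uᴴ * g) k).submatrix e id).det) := by
    rw [Real.log_mul hprod.ne' hpos.ne', ← Real.exp_sum, Real.log_exp]
  rw [hlog, gramDet_mul_eq hh]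
  by_cases hk : k.val + 1 < n
  · exact mul_le_mul_of_nonneg_left (Real.log_le_log (mul_pos hprod hpos)
      (prod_mul_normSq_le_re_det he _ fun i => (Real.exp_pos (s i)).le)) (gap_nonneg hanti hk)
  · have hbij : Function.Bijective e := by
      rw [Fintype.bijective_iff_injective_and_card]
      exact ⟨he, Fintype.card_congr (Equiv.subtypeUnivEquiv fun i => Fin.le_def.mpr (by omega))⟩
    rw [re_det_conjTranspose_mul_diagonal_mul_of_bijective hbij]

open Filter Topology in
/-- Semistability makes the regularized Kempf–Ness function proper on the unitary group of `J`. -/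
lemma exists_trace_le_of_energy_le {n : ℕ} {J : Matrix (Fin n) (Fin n) ℂ} (hJJ : J * J = 1)
    {lam : Fin 3 → Fin n → ℝ} (hanti : ∀ j, Antitone (lam j)) (hlam : ∑ j, ∑ i, lam j i = 0)
    {g : Fin 3 → Matrix (Fin n) (Fin n) ℂ} (hg : ∀ j, (g j)ᴴ * J * g j = J)
    (hss : Semistable lam g) {δ : ℝ} (hδ : 0 < δ) (C : ℝ) :
    ∃ R : ℝ, ∀ h : Matrix (Fin n) (Fin n) ℂ, hᴴ * J * h = J → energy lam g δ h ≤ C →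
      (hᴴ * h).trace.re ≤ R := by
  by_contra! hbad
  choose h hJh hE hR using fun N : ℕ => hbad (Real.exp (N + 1))
  choose U s hU hs hUs hsle using fun N => exists_polar hJJ (hJh N)
  set π : ℕ → ℝ := fun N => Real.log ((h N)ᴴ * h N).trace.re with hπ
  have hπN : ∀ N : ℕ, (N : ℝ) + 1 ≤ π N := fun N => by
    rw [hπ, ← Real.log_exp ((N : ℝ) + 1)]
    exact Real.log_le_log (Real.exp_pos _) (hR N).le
  have hπpos : ∀ N, 0 < π N := fun N => lt_of_lt_of_le (by positivity) (hπN N)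
  let 𝒰 : Ultrafilter ℕ := hyperfilter ℕ
  have h𝒰 : (𝒰 : Filter ℕ) ≤ atTop := Nat.hyperfilter_le_atTop
  have hπlim : Tendsto π 𝒰 atTop :=
    (tendsto_atTop_mono hπN (tendsto_atTop_add_const_right _ _ tendsto_natCast_atTop_atTop)).mono_left
      h𝒰
  obtain ⟨V, hV, hVlim⟩ : ∃ V ∈ {Q : Matrix (Fin n) (Fin n) ℂ | Q * Qᴴ = 1},
      Tendsto U 𝒰 (𝓝 V) :=
    (isCompact_setOf_mul_conjTranspose_eq_one n n).ultrafilter_le_nhds (𝒰.map U)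
      (tendsto_principal.mpr (Eventually.of_forall fun N => mul_eq_one_comm.mp (hU N)) :
        Tendsto U 𝒰 (𝓟 _))
  have hmem : ∀ N, (fun i => s N i / π N) ∈
      Set.pi Set.univ fun _ : Fin n => Set.Icc (-1 : ℝ) 1 := fun N i _ => by
    rw [Set.mem_Icc, ← abs_le, abs_div, abs_of_pos (hπpos N), div_le_one (hπpos N)]
    exact hsle N i
  obtain ⟨t, -, htlim⟩ := (isCompact_univ_pi fun _ => isCompact_Icc).ultrafilter_le_nhds
    (𝒰.map fun N i => s N i / π N) (tendsto_principal.mpr (Eventually.of_forall hmem) :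
      Tendsto (fun N i => s N i / π N) 𝒰 (𝓟 _))
  have hti : ∀ i, Tendsto (fun N => s N i / π N) 𝒰 (𝓝 (t i)) := tendsto_pi_nhds.mp htlim
  have htanti : Antitone t := fun i j hij => le_of_tendsto_of_tendsto' (hti j) (hti i) fun N =>
    div_le_div_of_nonneg_right (hs N hij) (hπpos N).le
  have hVV : Vᴴ * V = 1 := mul_eq_one_comm.mp hV
  have hdetV : ∀ j, IsUnit (Vᴴ * g j).det := fun j => by
    rw [det_mul]
    exact (IsUnit.of_mul_eq_one _ (by rw [← det_mul, hVV, det_one])).mul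
      (det_ne_zero_of_conjTranspose_mul_mul_eq hJJ (hg j)).isUnit
  choose e he hedet hecard using fun j k =>
    exists_minor_ne_zero (cols (Vᴴ * g j) k) (rank_cols_of_isUnit_det (hdetV j) k)
  let D : Fin 3 → Fin n → Matrix (Fin n) (Fin n) ℂ → ℝ := fun j k W =>
    Complex.normSq ((cols (Wᴴ * g j) k).submatrix (e j k) id).det
  have hDcont : ∀ j k, Continuous (D j k) := by
    intro j k
    have h1 : Continuous fun W : Matrix (Fin n) (Fin n) ℂ =>
        (cols (Wᴴ * g j) k).submatrix (e j k) id :=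
      (((continuous_id.matrix_conjTranspose).matrix_mul continuous_const).matrix_submatrix
        _ _).matrix_submatrix _ _
    exact Complex.continuous_normSq.comp h1.matrix_det
  have hDV : ∀ j k, D j k V ≠ 0 := fun j k => (Complex.normSq_pos.mpr (hedet j k)).ne'
  have hDlim : ∀ j k, Tendsto (fun N => D j k (U N)) 𝒰 (𝓝 (D j k V)) := fun j k =>
    ((hDcont j k).tendsto V).comp hVlim
  have hlow : ∀ᶠ N in (𝒰 : Filter ℕ), ∑ j, ∑ k, gap (lam j) k * (∑ a, s N (e j k a) / π N +
      Real.log (D j k (U N)) / π N) + δ ≤ C / π N := by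
    have h1 : ∀ᶠ N in (𝒰 : Filter ℕ), ∀ j k, D j k (U N) ≠ 0 :=
      eventually_all.mpr fun j => eventually_all.mpr fun k => (hDlim j k).eventually_ne (hDV j k)
    filter_upwards [h1] with N hN
    rw [le_div_iff₀ (hπpos N)]
    refine le_trans (le_of_eq ?_) ((add_le_add_left (Finset.sum_le_sum fun j _ =>
      Finset.sum_le_sum fun k _ => gap_mul_le_gap_mul_log_gramDet (hanti j) (hUs N) (he j k)
        fun h0 => hN j k (by simp only [D, h0, map_zero])) (δ * π N)).trans (hE N))
    rw [add_mul, Finset.sum_mul]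
    congr 1
    refine Finset.sum_congr rfl fun j _ => ?_
    rw [Finset.sum_mul]
    refine Finset.sum_congr rfl fun k _ => ?_
    rw [mul_assoc, ← Finset.sum_div, ← add_div, div_mul_cancel₀ _ (hπpos N).ne']
  have hlim : Tendsto (fun N => ∑ j, ∑ k, gap (lam j) k * (∑ a, s N (e j k a) / π N +
      Real.log (D j k (U N)) / π N) + δ) 𝒰
      (𝓝 (∑ j, ∑ k, gap (lam j) k * (∑ a, t (e j k a) + 0) + δ)) :=
    (tendsto_finsetSum _ fun j _ => tendsto_finsetSum _ fun k _ =>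
      ((tendsto_finsetSum _ fun a _ => hti _).add
        (((hDlim j k).log (hDV j k)).div_atTop hπlim)).const_mul _).add_const _
  have hle := le_of_tendsto_of_tendsto hlim (tendsto_const_nhds.div_atTop hπlim) hlow
  have hnonneg := sum_minor_weight_nonneg hlam hss (V := Vᴴ) (by rwa [conjTranspose_conjTranspose])
    htanti hecard
  simp only [add_zero] at hle
  linarith

open scoped ComplexOrder in
lemma gramDet_pos {n : ℕ} {M : Matrix (Fin n) (Fin n) ℂ} (hM : IsUnit M.det) (k : Fin n) :
    0 < gramDet M k := by
  have h1 : LinearIndependent ℂ M.col :=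
    linearIndependent_cols_iff_isUnit.mpr ((isUnit_iff_isUnit_det _).mpr hM)
  have h2 : LinearIndependent ℂ (cols M k).col := h1.comp _ Subtype.val_injective
  exact (Complex.pos_iff.mp
    (PosDef.conjTranspose_mul_self _ (mulVec_injective_iff.mpr h2)).det_pos).1

lemma re_trace_conjTranspose_mul_self {m n : Type*} [Fintype m] [Fintype n] (h : Matrix m n ℂ) :
    (hᴴ * h).trace.re = ∑ i, ∑ a, Complex.normSq (h a i) := by
  simp [trace, Matrix.mul_apply, Complex.mul_re, Complex.normSq_apply]

lemma re_trace_conjTranspose_mul_self_pos {n : ℕ} [NeZero n] {h : Matrix (Fin n) (Fin n) ℂ}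
    (hh : IsUnit h.det) : 0 < (hᴴ * h).trace.re := by
  rw [re_trace_conjTranspose_mul_self]
  refine lt_of_le_of_ne (Finset.sum_nonneg fun i _ => Finset.sum_nonneg fun a _ =>
    Complex.normSq_nonneg _) fun h0 => hh.ne_zero ?_
  have h1 : h = 0 := by
    ext a i
    have h2 := (Finset.sum_eq_zero_iff_of_nonneg fun i _ => Finset.sum_nonneg fun a _ =>
      Complex.normSq_nonneg (h a i)).mp h0.symm i (Finset.mem_univ i)
    exact Complex.normSq_eq_zero.mp ((Finset.sum_eq_zero_iff_of_nonneg fun a _ =>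
      Complex.normSq_nonneg (h a i)).mp h2 a (Finset.mem_univ a))
  rw [h1]
  exact det_zero

lemma isCompact_setOf_trace_le {n : ℕ} (J : Matrix (Fin n) (Fin n) ℂ) (R : ℝ) :
    IsCompact {h : Matrix (Fin n) (Fin n) ℂ | hᴴ * J * h = J ∧ (hᴴ * h).trace.re ≤ R} := by
  have hsub : {h : Matrix (Fin n) (Fin n) ℂ | hᴴ * J * h = J ∧ (hᴴ * h).trace.re ≤ R} ⊆
      Set.pi Set.univ fun _ : Fin n => Set.pi Set.univ fun _ : Fin n =>
        Metric.closedBall 0 (R + 1) := by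
    rintro h ⟨-, hR⟩ a - i -
    rw [re_trace_conjTranspose_mul_self] at hR
    have h1 : Complex.normSq (h a i) ≤ R := ((Finset.single_le_sum
      (f := fun a => Complex.normSq (h a i)) (fun a _ => Complex.normSq_nonneg _)
      (Finset.mem_univ a)).trans (Finset.single_le_sum
      (f := fun i => ∑ a, Complex.normSq (h a i)) (fun i _ => Finset.sum_nonneg fun a _ =>
        Complex.normSq_nonneg _) (Finset.mem_univ i))).trans hR
    rw [mem_closedBall_zero_iff]
    rw [Complex.normSq_eq_norm_sq] at h1
    nlinarith [norm_nonneg (h a i), sq_nonneg (‖h a i‖ - 1)]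
  refine IsCompact.of_isClosed_subset (isCompact_univ_pi fun _ => isCompact_univ_pi fun _ =>
    isCompact_closedBall 0 _) ?_ hsub
  exact (isClosed_eq (by fun_prop) continuous_const).inter
    (isClosed_le (Complex.continuous_re.comp (Continuous.matrix_trace (by fun_prop)))
      continuous_const)

lemma continuousOn_energy {n : ℕ} [NeZero n] {J : Matrix (Fin n) (Fin n) ℂ} (hJJ : J * J = 1)
    (lam : Fin 3 → Fin n → ℝ) {g : Fin 3 → Matrix (Fin n) (Fin n) ℂ}
    (hg : ∀ j, (g j)ᴴ * J * g j = J) (δ : ℝ) :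
    ContinuousOn (energy lam g δ) {h | hᴴ * J * h = J} := by
  have hunit : ∀ h ∈ {h : Matrix (Fin n) (Fin n) ℂ | hᴴ * J * h = J}, IsUnit h.det :=
    fun h hh => (det_ne_zero_of_conjTranspose_mul_mul_eq hJJ hh).isUnit
  refine ContinuousOn.add (continuousOn_finsetSum _ fun j _ => continuousOn_finsetSum _ fun k _ =>
    continuousOn_const.mul (ContinuousOn.log ?_ fun h hh => ?_)) (continuousOn_const.mul
    (ContinuousOn.log ?_ fun h hh => (re_trace_conjTranspose_mul_self_pos (hunit h hh)).ne'))
  · have h1 : Continuous fun h : Matrix (Fin n) (Fin n) ℂ => cols (h * g j) k :=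
      (continuous_id.matrix_mul continuous_const).matrix_submatrix _ _
    exact (Complex.continuous_re.comp
      (h1.matrix_conjTranspose.matrix_mul h1).matrix_det).continuousOn
  · refine (gramDet_pos ?_ k).ne'
    rw [det_mul]
    exact (hunit h hh).mul (det_ne_zero_of_conjTranspose_mul_mul_eq hJJ (hg j)).isUnit
  · exact (Complex.continuous_re.comp (Continuous.matrix_trace (by fun_prop))).continuousOn

lemma exists_forall_energy_le {n : ℕ} [NeZero n] {J : Matrix (Fin n) (Fin n) ℂ} (hJJ : J * J = 1)
    {lam : Fin 3 → Fin n → ℝ} (hanti : ∀ j, Antitone (lam j)) (hlam : ∑ j, ∑ i, lam j i = 0)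
    {g : Fin 3 → Matrix (Fin n) (Fin n) ℂ} (hg : ∀ j, (g j)ᴴ * J * g j = J)
    (hss : Semistable lam g) {δ : ℝ} (hδ : 0 < δ) :
    ∃ h : Matrix (Fin n) (Fin n) ℂ, hᴴ * J * h = J ∧
      ∀ h' : Matrix (Fin n) (Fin n) ℂ, h'ᴴ * J * h' = J → energy lam g δ h ≤ energy lam g δ h' := by
  obtain ⟨R, hR⟩ := exists_trace_le_of_energy_le hJJ hanti hlam hg hss hδ (energy lam g δ 1)
  have h1 : (1 : Matrix (Fin n) (Fin n) ℂ)ᴴ * J * 1 = J := by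
    rw [conjTranspose_one, Matrix.one_mul, Matrix.mul_one]
  obtain ⟨h, hh, hmin⟩ := (isCompact_setOf_trace_le J R).exists_isMinOn
    ⟨1, h1, hR 1 h1 le_rfl⟩ ((continuousOn_energy hJJ lam hg δ).mono fun h hh => hh.1)
  refine ⟨h, hh.1, fun h' hh' => ?_⟩
  rcases le_total (energy lam g δ h') (energy lam g δ 1) with hle | hle
  · exact hmin ⟨hh', hR h' hh' hle⟩
  · exact (hmin ⟨h1, hR 1 h1 le_rfl⟩ : energy lam g δ h ≤ energy lam g δ 1).trans hle

lemma hasDerivAt_mul_mul_apply {l m n o : Type*} [Fintype m] [Fintype n] {P : ℝ → Matrix m n ℂ}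
    {T : Matrix m n ℂ} {s₀ : ℝ} (hP : ∀ a b, HasDerivAt (fun s => P s a b) (T a b) s₀)
    (X : Matrix l m ℂ) (Y : Matrix n o ℂ) (a : l) (b : o) :
    HasDerivAt (fun s => (X * P s * Y) a b) ((X * T * Y) a b) s₀ := by
  simp only [Matrix.mul_apply]
  exact HasDerivAt.fun_sum fun j _ => (HasDerivAt.fun_sum fun i _ =>
    (hP i j).const_mul (X a i)).mul_const (Y j b)

lemma hasDerivAt_det {m : Type*} [Fintype m] [DecidableEq m] {P : ℝ → Matrix m m ℂ}
    {T : Matrix m m ℂ} {s₀ : ℝ} (h1 : P s₀ = 1)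
    (hP : ∀ a b, HasDerivAt (fun s => P s a b) (T a b) s₀) :
    HasDerivAt (fun s => (P s).det) T.trace s₀ := by
  simp only [det_apply']
  have h2 := HasDerivAt.fun_sum (u := Finset.univ) fun (τ : Equiv.Perm m) _ =>
    (HasDerivAt.fun_finsetProd (u := Finset.univ) fun i _ => hP (τ i) i).const_mul
      ((Equiv.Perm.sign τ : ℤ) : ℂ)
  refine h2.congr_deriv ?_
  simp only [Finset.mul_sum]
  rw [Finset.sum_comm]
  refine Finset.sum_congr rfl fun i _ => ?_
  rw [Finset.sum_eq_single 1]
  · simp [h1]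
  · intro τ _ hτ
    obtain ⟨j, hji, hj⟩ : ∃ j, j ≠ i ∧ τ j ≠ j := by
      by_contra! h3
      refine hτ (Equiv.ext fun j => ?_)
      by_cases hji : j = i
      · subst hji
        by_contra h4
        exact h4 (τ.injective (h3 _ h4))
      · exact h3 j hji
    rw [Finset.prod_eq_zero (Finset.mem_erase.mpr ⟨hji, Finset.mem_univ j⟩), zero_smul, mul_zero]
    rw [h1, one_apply_ne hj]
  · exact fun h => absurd (Finset.mem_univ _) h

open scoped Matrix.Norms.Operator in
lemma exists_curve {n : ℕ} {J T : Matrix (Fin n) (Fin n) ℂ} (hJJ : J * J = 1) (hT : Tᴴ = T)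
    (hJT : J * T * J = -T) :
    ∃ c : ℝ → Matrix (Fin n) (Fin n) ℂ, (∀ s, (c s)ᴴ * J * c s = J) ∧ c 0 = 1 ∧
      ∀ a b, HasDerivAt (fun s => ((c s)ᴴ * c s) a b) (T a b) 0 := by
  have hstar : ∀ s : ℝ, (NormedSpace.exp (s • T))ᴴ = NormedSpace.exp (s • T) := fun s => by
    rw [← exp_conjTranspose, conjTranspose_smul, hT, star_trivial]
  have hJinv : J⁻¹ = J := inv_eq_right_inv hJJ
  have hneg : ∀ s : ℝ, J * NormedSpace.exp (s • T) * J = NormedSpace.exp (-(s • T)) := fun s => by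
    have := Matrix.exp_conj J (s • T) (IsUnit.of_mul_eq_one _ hJJ)
    rw [hJinv] at this
    rw [← this, Matrix.mul_smul, Matrix.smul_mul, hJT, smul_neg]
  have hadd : ∀ s t : ℝ, NormedSpace.exp (s • T) * NormedSpace.exp (t • T) =
      NormedSpace.exp ((s + t) • T) := fun s t => by
    rw [add_smul, Matrix.exp_add_of_commute]
    exact ((Commute.refl T).smul_left s).smul_right t
  refine ⟨fun s => NormedSpace.exp ((s / 2) • T), fun s => ?_, by simp, fun a b => ?_⟩
  · rw [hstar]
    have h1 : NormedSpace.exp ((s / 2) • T) * (J * NormedSpace.exp ((s / 2) • T) * J) = 1 := by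
      rw [hneg, ← neg_smul, hadd, add_neg_cancel, zero_smul, NormedSpace.exp_zero]
    calc NormedSpace.exp ((s / 2) • T) * J * NormedSpace.exp ((s / 2) • T)
        = NormedSpace.exp ((s / 2) • T) * (J * NormedSpace.exp ((s / 2) • T) * J) * J := by
          simp only [Matrix.mul_assoc, hJJ, Matrix.mul_one]
      _ = J := by rw [h1, Matrix.one_mul]
  · simp only [hstar, hadd, add_halves]
    have h1 := hasDerivAt_exp_smul_const (𝕂 := ℝ) T (0 : ℝ)
    rw [zero_smul, NormedSpace.exp_zero, one_mul] at h1
    exact hasDerivAt_pi.mp (hasDerivAt_pi.mp h1 a) b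

lemma gramDet_mul_of_blockTriangular {n : ℕ} (M : Matrix (Fin n) (Fin n) ℂ)
    {b : Matrix (Fin n) (Fin n) ℂ} (hb : b.BlockTriangular id) (k : Fin n) :
    gramDet (M * b) k = Complex.normSq (lead b k).det * gramDet M k := by
  have h1 : (cols (M * b) k)ᴴ * cols (M * b) k =
      (lead b k)ᴴ * ((cols M k)ᴴ * cols M k) * lead b k := by
    rw [cols_mul_of_blockTriangular M hb, conjTranspose_mul]
    simp only [Matrix.mul_assoc]
  rw [gramDet, h1, det_mul, det_mul, det_conjTranspose, mul_right_comm, Complex.star_def,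
    ← Complex.normSq_eq_conj_mul_self, Complex.re_ofReal_mul, gramDet]

lemma hasDerivAt_log_gramDet {n : ℕ} {u b T : Matrix (Fin n) (Fin n) ℂ} (hu : uᴴ * u = 1)
    (hb : b.BlockTriangular id) (hub : IsUnit (u * b).det)
    {c : ℝ → Matrix (Fin n) (Fin n) ℂ} (hc0 : c 0 = 1)
    (hc : ∀ a b, HasDerivAt (fun s => ((c s)ᴴ * c s) a b) (T a b) 0) (k : Fin n) :
    HasDerivAt (fun s => Real.log (gramDet (c s * (u * b)) k))
      (∑ i, if i ≤ k then ((uᴴ * T * u) i i).re else 0) 0 := by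
  let E : ℝ → Matrix {i : Fin n // i ≤ k} {i : Fin n // i ≤ k} ℂ := fun s =>
    (cols u k)ᴴ * ((c s)ᴴ * c s) * cols u k
  have hE0 : E 0 = 1 := by
    have h1 : E 0 = (uᴴ * u).submatrix Subtype.val Subtype.val := by
      simp only [E, hc0, conjTranspose_one, Matrix.mul_one]
      rfl
    rw [h1, hu, submatrix_one _ Subtype.val_injective]
  have hEdet := hasDerivAt_det hE0 (hasDerivAt_mul_mul_apply hc (cols u k)ᴴ (cols u k))
  have hre : HasDerivAt (fun s => (E s).det.re) ((cols u k)ᴴ * T * cols u k).trace.re 0 :=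
    Complex.reCLM.hasFDerivAt.comp_hasDerivAt (0 : ℝ) hEdet
  have hgram : ∀ s, gramDet (c s * (u * b)) k =
      Complex.normSq (lead b k).det * (E s).det.re := fun s => by
    rw [← Matrix.mul_assoc, gramDet_mul_of_blockTriangular _ hb, gramDet, cols_mul,
      conjTranspose_mul]
    simp only [E, Matrix.mul_assoc]
  have hE1 : (E 0).det.re = 1 := by rw [hE0, det_one, Complex.one_re]
  have hL : Complex.normSq (lead b k).det ≠ 0 := by
    have h1 := gramDet_pos hub k
    have h2 := hgram 0
    rw [hc0, Matrix.one_mul, hE1, mul_one] at h2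
    rw [← h2]
    exact h1.ne'
  simp only [hgram]
  have h3 := (hre.const_mul (Complex.normSq (lead b k).det)).log (by rwa [hE1, mul_one])
  refine h3.congr_deriv ?_
  rw [hE1, mul_one, mul_div_cancel_left₀ _ hL, trace, Complex.re_sum, ← Finset.sum_filter,
    Finset.sum_subtype (p := fun i => i ≤ k) _ (by simp)]
  rfl

lemma re_trace_mul_conjDiag {n : ℕ} (S U : Matrix (Fin n) (Fin n) ℂ) (d : Fin n → ℝ) :
    (S * conjDiag U d).trace.re = ∑ i, d i * ((Uᴴ * S * U) i i).re := by
  have h1 : (S * conjDiag U d).trace = (Uᴴ * S * U * diagonal fun i => (d i : ℂ)).trace := by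
    rw [conjDiag, ← Matrix.mul_assoc, trace_mul_comm, ← Matrix.mul_assoc, ← Matrix.mul_assoc]
  rw [h1, trace, Complex.re_sum]
  refine Finset.sum_congr rfl fun i _ => ?_
  rw [diag_apply, mul_diagonal, mul_comm, Complex.re_ofReal_mul]

lemma neg_mul_le_re_trace {n : ℕ} {U : Matrix (Fin n) (Fin n) ℂ} (hU : Uᴴ * U = 1)
    (d : Fin n → ℝ) (h : Matrix (Fin n) (Fin n) ℂ) :
    -((∑ i, |d i|) * (hᴴ * h).trace.re) ≤ (hᴴ * conjDiag U d * h).trace.re := by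
  have h1 : (hᴴ * conjDiag U d * h).trace.re =
      ∑ i, d i * ∑ a, Complex.normSq ((Uᴴ * h) i a) := by
    have h2 : (hᴴ * conjDiag U d * h).trace = ((Uᴴ * h)ᴴ * (diagonal fun i => (d i : ℂ)) *
        (Uᴴ * h)).trace := by
      rw [conjTranspose_mul, conjTranspose_conjTranspose, conjDiag]
      simp only [Matrix.mul_assoc]
    rw [h2, trace, Complex.re_sum]
    simp_rw [Finset.mul_sum]
    rw [Finset.sum_comm]
    refine Finset.sum_congr rfl fun a _ => ?_
    rw [diag_apply, Matrix.mul_apply, Complex.re_sum]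
    refine Finset.sum_congr rfl fun i _ => ?_
    rw [mul_diagonal, conjTranspose_apply, mul_right_comm, Complex.star_def,
      ← Complex.normSq_eq_conj_mul_self, mul_comm, Complex.re_ofReal_mul, Complex.ofReal_re]
  have h3 : (hᴴ * h).trace.re = ∑ i, ∑ a, Complex.normSq ((Uᴴ * h) i a) := by
    rw [Finset.sum_comm, ← re_trace_conjTranspose_mul_self, conjTranspose_mul,
      conjTranspose_conjTranspose, Matrix.mul_assoc, ← Matrix.mul_assoc U,
      mul_eq_one_comm.mp hU, Matrix.one_mul]
  have h4 : ∀ i, 0 ≤ ∑ a, Complex.normSq ((Uᴴ * h) i a) := fun i =>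
    Finset.sum_nonneg fun a _ => Complex.normSq_nonneg _
  rw [h1, h3, Finset.mul_sum, ← Finset.sum_neg_distrib]
  refine Finset.sum_le_sum fun i _ => ?_
  have h5 : |d i| ≤ ∑ i, |d i| :=
    Finset.single_le_sum (f := fun i => |d i|) (fun i _ => abs_nonneg _) (Finset.mem_univ i)
  nlinarith [h4 i, neg_abs_le (d i), mul_le_mul_of_nonneg_right h5 (h4 i),
    mul_le_mul_of_nonneg_right (neg_abs_le (d i)) (h4 i)]

lemma conjTranspose_mul_mul_mul_eq {n : ℕ} {J g h : Matrix (Fin n) (Fin n) ℂ}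
    (hg : gᴴ * J * g = J) (hh : hᴴ * J * h = J) : (h * g)ᴴ * J * (h * g) = J := by
  calc (h * g)ᴴ * J * (h * g) = gᴴ * (hᴴ * J * h) * g := by
        rw [conjTranspose_mul]
        simp only [Matrix.mul_assoc]
    _ = J := by rw [hh, hg]

/-- The antisymmetric matrices come from criticality of the energy at its minimizer. -/
lemma exists_antisymmetric_of_pos {n : ℕ} [NeZero n] {σ : Fin n → Fin n}
    (hσ : Function.Involutive σ) {lam : Fin 3 → Fin n → ℝ} (hanti : ∀ j, Antitone (lam j))
    (hflip : ∀ j i, lam j (σ i) = -lam j i) {g : Fin 3 → Matrix (Fin n) (Fin n) ℂ}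
    (hg : ∀ j, (g j)ᴴ * permOf σ * g j = permOf σ) (hss : Semistable lam g) {δ : ℝ} (hδ : 0 < δ) :
    ∃ v : Fin 3 → Matrix (Fin n) (Fin n) ℂ, (∀ j, (v j)ᴴ * v j = 1) ∧
      (∀ j, permOf σ * conjDiag (v j) (lam j) * permOf σ = -conjDiag (v j) (lam j)) ∧
      ((∑ j, conjDiag (v j) (lam j)) * ∑ j, conjDiag (v j) (lam j)).trace.re ≤
        δ * ∑ j, ∑ i, |lam j i| := by
  have hJJ := permOf_mul_self hσ
  have hlam : ∑ j, ∑ i, lam j i = 0 := Finset.sum_eq_zero fun j _ => by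
    have h1 := Equiv.sum_comp (hσ.toPerm σ) (lam j)
    simp only [Function.Involutive.coe_toPerm, hflip, Finset.sum_neg_distrib] at h1
    linarith
  obtain ⟨h, hh, hmin⟩ := exists_forall_energy_le hJJ hanti hlam hg hss hδ
  have hhg : ∀ j, (h * g j)ᴴ * permOf σ * (h * g j) = permOf σ := fun j =>
    conjTranspose_mul_mul_mul_eq (hg j) hh
  choose u b hu hb hub using fun j => exists_unitary_mul_upperTriangular (h * g j)
  have hA : ∀ j, permOf σ * conjDiag (u j) (lam j) * permOf σ = -conjDiag (u j) (lam j) :=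
    fun j => conj_conjDiag_eq_neg hσ (hanti j) (hflip j) (hhg j) (hu j) (hb j) (hub j)
  refine ⟨u, hu, hA, ?_⟩
  set T := ∑ j, conjDiag (u j) (lam j) with hTdef
  have hT : Tᴴ = T := by
    rw [hTdef, conjTranspose_sum]
    exact Finset.sum_congr rfl fun j _ => conjDiag_isHermitian _ _
  have hJT : permOf σ * T * permOf σ = -T := by
    rw [hTdef, Finset.mul_sum, Finset.sum_mul, ← Finset.sum_neg_distrib]
    exact Finset.sum_congr rfl fun j _ => hA j
  obtain ⟨c, hcJ, hc0, hc⟩ := exists_curve hJJ hT hJT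
  have htr : 0 < (hᴴ * h).trace.re :=
    re_trace_conjTranspose_mul_self_pos (det_ne_zero_of_conjTranspose_mul_mul_eq hJJ hh).isUnit
  have hderiv_gram : ∀ j, HasDerivAt
      (fun s => ∑ k, gap (lam j) k * Real.log (gramDet (c s * h * g j) k))
      (T * conjDiag (u j) (lam j)).trace.re 0 := fun j => by
    rw [re_trace_mul_conjDiag, ← sum_gap_mul_sum (lam j) fun i => (((u j)ᴴ * T * u j) i i).re]
    have hdet : IsUnit (u j * b j).det := by
      rw [← hub j]
      exact (det_ne_zero_of_conjTranspose_mul_mul_eq hJJ (hhg j)).isUnit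
    simp only [Matrix.mul_assoc (c _), hub j]
    exact HasDerivAt.fun_sum fun k _ =>
      (hasDerivAt_log_gramDet (hu j) (hb j) hdet hc0 hc k).const_mul _
  have hderiv_trace : HasDerivAt (fun s => Real.log ((c s * h)ᴴ * (c s * h)).trace.re)
      ((hᴴ * T * h).trace.re / (hᴴ * h).trace.re) 0 := by
    have h1 : HasDerivAt (fun s => (hᴴ * ((c s)ᴴ * c s) * h).trace.re) (hᴴ * T * h).trace.re 0 := by
      simp only [trace, diag_apply, Complex.re_sum]
      exact HasDerivAt.fun_sum fun i _ => Complex.reCLM.hasFDerivAt.comp_hasDerivAt (0 : ℝ)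
        (hasDerivAt_mul_mul_apply hc hᴴ h i i)
    have h2 : ∀ s, (c s * h)ᴴ * (c s * h) = hᴴ * ((c s)ᴴ * c s) * h := fun s => by
      rw [conjTranspose_mul]
      simp only [Matrix.mul_assoc]
    have h3 : hᴴ * ((c 0)ᴴ * c 0) * h = hᴴ * h := by
      rw [hc0, conjTranspose_one, Matrix.mul_one, Matrix.mul_one]
    simp only [h2]
    have h4 := h1.log (by rw [h3]; exact htr.ne')
    rwa [h3] at h4
  have hderiv : HasDerivAt (fun s => energy lam g δ (c s * h))
      (∑ j, (T * conjDiag (u j) (lam j)).trace.re +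
        δ * ((hᴴ * T * h).trace.re / (hᴴ * h).trace.re)) 0 :=
    (HasDerivAt.fun_sum fun j _ => hderiv_gram j).add (hderiv_trace.const_mul δ)
  have hlocal : IsLocalMin (fun s => energy lam g δ (c s * h)) 0 :=
    Filter.Eventually.of_forall fun s => by
      simp only [hc0, Matrix.one_mul]
      exact hmin _ (conjTranspose_mul_mul_mul_eq hh (hcJ s))
  have hzero := hlocal.hasDerivAt_eq_zero hderiv
  have hTT : ∑ j, (T * conjDiag (u j) (lam j)).trace.re = (T * T).trace.re := by
    rw [← Complex.re_sum, ← trace_sum, ← Finset.mul_sum]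
  have hbound : -((∑ j, ∑ i, |lam j i|) * (hᴴ * h).trace.re) ≤ (hᴴ * T * h).trace.re := by
    rw [hTdef, Finset.mul_sum, Finset.sum_mul (s := Finset.univ) (a := h), trace_sum,
      Complex.re_sum, Finset.sum_mul, ← Finset.sum_neg_distrib]
    exact Finset.sum_le_sum fun j _ => neg_mul_le_re_trace (hu j) (lam j) h
  rw [hTT] at hzero
  have h1 : -(∑ j, ∑ i, |lam j i|) ≤ (hᴴ * T * h).trace.re / (hᴴ * h).trace.re := by
    rw [le_div_iff₀ htr]
    linarith
  nlinarith [mul_le_mul_of_nonneg_left h1 hδ.le]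

lemma continuous_conjDiag {n : ℕ} (d : Fin n → ℝ) : Continuous fun U => conjDiag U d := by
  unfold conjDiag
  fun_prop

open Filter Topology in
open scoped ComplexOrder in
theorem exists_antisymmetric {n : ℕ} {σ : Fin n → Fin n} (hσ : Function.Involutive σ)
    {lam : Fin 3 → Fin n → ℝ} (hanti : ∀ j, Antitone (lam j))
    (hflip : ∀ j i, lam j (σ i) = -lam j i) {u : Fin 3 → Matrix (Fin n) (Fin n) ℂ}
    (hu : ∀ j, (u j)ᴴ * u j = 1) (hsum : ∑ j, conjDiag (u j) (lam j) = 0) :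
    ∃ v : Fin 3 → Matrix (Fin n) (Fin n) ℂ, (∀ j, (v j)ᴴ * v j = 1) ∧
      (∀ j, permOf σ * conjDiag (v j) (lam j) * permOf σ = -conjDiag (v j) (lam j)) ∧
      ∑ j, conjDiag (v j) (lam j) = 0 := by
  rcases Nat.eq_zero_or_pos n with rfl | hn
  · exact ⟨u, hu, fun j => Subsingleton.elim _ _, hsum⟩
  have : NeZero n := ⟨hn.ne'⟩
  obtain ⟨g, hg, hss⟩ := exists_semistable_of_sum_conjDiag_eq_zero (permOf_conjTranspose hσ)
    (permOf_mul_self hσ) hanti hu hsum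
  choose w hw hwJ hwT using fun N : ℕ =>
    exists_antisymmetric_of_pos hσ hanti hflip hg hss (δ := 1 / ((N : ℝ) + 1)) (by positivity)
  let 𝒰 : Ultrafilter ℕ := hyperfilter ℕ
  have h𝒰 : (𝒰 : Filter ℕ) ≤ atTop := Nat.hyperfilter_le_atTop
  have hmem : ∀ N, w N ∈ Set.pi Set.univ fun _ : Fin 3 =>
      {Q : Matrix (Fin n) (Fin n) ℂ | Q * Qᴴ = 1} := fun N j _ => mul_eq_one_comm.mp (hw N j)
  obtain ⟨v, hv, hvlim⟩ := (isCompact_univ_pi fun _ : Fin 3 =>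
    isCompact_setOf_mul_conjTranspose_eq_one n n).ultrafilter_le_nhds (𝒰.map w)
      (tendsto_principal.mpr (Eventually.of_forall hmem) : Tendsto w 𝒰 (𝓟 _))
  have hvlim : Tendsto w 𝒰 (𝓝 v) := hvlim
  have hA : ∀ j, Continuous fun x : Fin 3 → Matrix (Fin n) (Fin n) ℂ => conjDiag (x j) (lam j) :=
    fun j => (continuous_conjDiag (lam j)).comp (continuous_apply j)
  have hclosed : IsClosed {x : Fin 3 → Matrix (Fin n) (Fin n) ℂ | ∀ j,
      permOf σ * conjDiag (x j) (lam j) * permOf σ = -conjDiag (x j) (lam j)} := by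
    rw [Set.ofPred_forall]
    exact isClosed_iInter fun j => isClosed_eq
      ((continuous_const.matrix_mul (hA j)).matrix_mul continuous_const) (hA j).neg
  refine ⟨v, fun j => mul_eq_one_comm.mp (hv j (Set.mem_univ j)),
    hclosed.mem_of_tendsto hvlim (Eventually.of_forall hwJ), ?_⟩
  have hT : Continuous fun x : Fin 3 → Matrix (Fin n) (Fin n) ℂ =>
      ∑ j, conjDiag (x j) (lam j) := continuous_finsetSum _ fun j _ => hA j
  have hle : ((∑ j, conjDiag (v j) (lam j)) * ∑ j, conjDiag (v j) (lam j)).trace.re ≤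
      0 * ∑ j, ∑ i, |lam j i| :=
    le_of_tendsto_of_tendsto'
      (((Complex.continuous_re.comp (hT.matrix_mul hT).matrix_trace).tendsto v).comp hvlim)
      ((tendsto_one_div_add_atTop_nhds_zero_nat.mono_left h𝒰).mul_const _) hwT
  have hherm : (∑ j, conjDiag (v j) (lam j))ᴴ = ∑ j, conjDiag (v j) (lam j) := by
    rw [conjTranspose_sum]
    exact Finset.sum_congr rfl fun j _ => conjDiag_isHermitian _ _
  set T := ∑ j, conjDiag (v j) (lam j)
  have hnonneg := Complex.nonneg_iff.mp (posSemidef_conjTranspose_mul_self T).trace_nonneg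
  rw [← trace_conjTranspose_mul_self_eq_zero_iff]
  rw [hherm] at hnonneg ⊢
  exact Complex.ext (le_antisymm (hle.trans_eq (zero_mul _)) hnonneg.1) hnonneg.2.symm

lemma mem_SingularCone_of_mem_Horn {p q : ℕ} (hpq : q ≤ p) {x y z : Fin q → ℝ}
    (hx : DecrNonneg x) (hy : DecrNonneg y) (hz : DecrNonneg z)
    (h : (tildeVec p q x, tildeVec p q y, tildeVec p q z) ∈ Horn (p + q)) :
    (x, y, z) ∈ SingularCone p q := by
  obtain ⟨A, B, C, hA, hB, hC, hsum, hA', hB', hC'⟩ := h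
  simp only at hA' hB' hC'
  obtain ⟨a, ha, hAa⟩ := exists_conjDiag_eigsDesc hA
  obtain ⟨b, hb, hBb⟩ := exists_conjDiag_eigsDesc hB
  obtain ⟨c, hc, hCc⟩ := exists_conjDiag_eigsDesc hC
  rw [hA'] at hAa
  rw [hB'] at hBb
  rw [hC'] at hCc
  have hσ := foldIdx_involutive p q
  have hxyz : ∀ j : Fin 3, DecrNonneg (![x, y, z] j) := by
    intro j; fin_cases j <;> assumption
  obtain ⟨v, hv, hvJ, hvsum⟩ := exists_antisymmetric hσ
    (lam := fun j => tildeVec p q (![x, y, z] j)) (u := ![a, b, c])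
    (fun j => tildeVec_antitone (hxyz j)) (fun j i => tildeVec_foldIdx hpq _ i)
    (by intro j; fin_cases j <;> assumption)
    (by simp [Fin.sum_univ_three, ← hAa, ← hBb, ← hCc, hsum])
  obtain ⟨W, hW, hW', hJW⟩ := exists_unitary_diagonalizing_involution
    (permOf_conjTranspose hσ) (permOf_mul_self hσ) (trace_permOf_foldIdx hpq)
  have hWJ : Wᴴ * permOf (foldIdx p q) = signMat p q * Wᴴ := by
    have := congrArg conjTranspose hJW
    rw [conjTranspose_mul, conjTranspose_mul, permOf_conjTranspose hσ,
      signMat_conjTranspose] at this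
    exact this
  have key : ∀ j, ∃ M : Matrix (Fin p) (Fin q) ℂ,
      conjDiag (v j) (tildeVec p q (![x, y, z] j)) = W * dilation M * Wᴴ := by
    intro j
    set S := conjDiag (v j) (tildeVec p q (![x, y, z] j)) with hS
    obtain ⟨M, hM⟩ := exists_eq_dilation (N := Wᴴ * S * W)
      (isHermitian_conjTranspose_mul_mul W (conjDiag_isHermitian _ _)) (by
        calc signMat p q * (Wᴴ * S * W) * signMat p q
            = (signMat p q * Wᴴ) * S * (W * signMat p q) := by
              simp only [Matrix.mul_assoc]
          _ = Wᴴ * (permOf (foldIdx p q) * S * permOf (foldIdx p q)) * W := by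
              rw [← hWJ, ← hJW]; simp only [Matrix.mul_assoc]
          _ = -(Wᴴ * S * W) := by rw [hS, hvJ j, Matrix.mul_neg, Matrix.neg_mul])
    refine ⟨M, ?_⟩
    rw [← hM, ← Matrix.mul_assoc, ← Matrix.mul_assoc, hW', Matrix.one_mul, Matrix.mul_assoc, hW',
      Matrix.mul_one]
  choose M hM using key
  have hsv : ∀ j, singularValues (M j) = ![x, y, z] j := by
    intro j
    apply tildeVec_injective (p := p)
    rw [← eigsDesc_conj_dilation hpq (M j) hW (conj_dilation_isHermitian _ _)]
    exact eigsDesc_conjDiag (hv j) (tildeVec_antitone (hxyz j)) _ (hM j).symm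
  refine ⟨M 0, M 1, M 2, ?_, hsv 0, hsv 1, hsv 2⟩
  rw [Fin.sum_univ_three, hM, hM, hM, ← Matrix.add_mul, ← Matrix.add_mul, ← Matrix.mul_add,
    ← Matrix.mul_add] at hvsum
  have h1 : dilation (M 0) + dilation (M 1) + dilation (M 2) = 0 := by
    have := congrArg (fun X => Wᴴ * X * W) hvsum
    simp only [Matrix.mul_assoc, hW, Matrix.mul_one, Matrix.mul_zero, Matrix.zero_mul] at this
    rwa [← Matrix.mul_assoc, hW, Matrix.one_mul] at this
  have h2 := congrArg toBlocks₁₂ h1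
  simp only [dilation, fromBlocks_add, toBlocks_fromBlocks₁₂] at h2
  exact h2

/-- For `p ≥ q ≥ 1` and `(x, y, z) ∈ (ℝ^q_{++})^3`:
`(x, y, z) ∈ Singular(p,q)` if and only if `(x̃, ỹ, z̃) ∈ Horn(p+q)`. -/
theorem singular_iff_horn_tilde (p q : ℕ) (hq : 1 ≤ q) (hpq : q ≤ p)
    (x y z : Fin q → ℝ) (hx : DecrNonneg x) (hy : DecrNonneg y) (hz : DecrNonneg z) :
    (x, y, z) ∈ SingularCone p q ↔
      (tildeVec p q x, tildeVec p q y, tildeVec p q z) ∈ Horn (p + q) :=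
  ⟨mem_Horn_of_mem_SingularCone hpq, mem_SingularCone_of_mem_Horn hpq hx hy hz⟩
end

section
/- Let X_• be a polarized subset of [q] of cardinal r ≥ 1 and let p ≥ q. Then |λ(X^p_•)| = |X_−| − |X_+| + (p+q+1)·♯X_+ − r(r+1)/2, and |λ(X̃^p_•)| = |X_−| − |X_+| + (p+q+1)·♯X_+ − r(r+1)/2 − (♯X_+)² − 2δ_{X_•}. In particular |λ(X^p_•)| − |λ(X̃^p_•)| = (♯X_+)² + 2δ_{X_•}. -/
open Matrix

/-- `X^p_•` : given a polarized subset `X_• = (X_+, X_−)` of `[q]`, the subset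
`X_+ ∪ {p+q+1−x : x ∈ X_−}` of `[p+q]`. -/
def polToSet (p q : ℕ) (Xplus Xminus : Finset ℕ) : Finset ℕ :=
  Xplus ∪ Xminus.image (fun a => p + q + 1 - a)

/-- `λ(X)` for a subset `X = {x_1 < … < x_r}` of `[m]` : the vector with entries
`λ_a = m − r + a − x_a`, viewed in `ℝ^r`. -/
noncomputable def lambdaOf (m r : ℕ) (S : Finset ℕ) : Fin r → ℝ :=
  fun a => (m : ℝ) - r + (a.val + 1) - ((S.sort (· ≤ ·)).getD a.val 0 : ℝ)

/-- `(X^p_•)'` : writing the complement of `S = X^p_•` in `[p+q]` as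
`{u_1 < … < u_{p+q−r}}` and `S^o = {p+q+1−x : x ∈ S}`, this is
`{i ∈ [p+q−r] : u_i ∈ S^o}`. -/
def primeSet (p q r : ℕ) (S : Finset ℕ) : Finset ℕ :=
  (Finset.Icc 1 (p + q - r)).filter
    (fun i => ((Finset.Icc 1 (p + q) \ S).sort (· ≤ ·)).getD (i - 1) 0
      ∈ S.image (fun a => p + q + 1 - a))

/-- `X̃^p_• = {k ∈ [p+q−r] : p+q−r+1−k ∈ (X^p_•)'}`. -/
def tildeSet (p q r : ℕ) (S : Finset ℕ) : Finset ℕ :=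
  (Finset.Icc 1 (p + q - r)).filter (fun k => p + q - r + 1 - k ∈ primeSet p q r S)

/-- `1^r_α ∈ ℝ^r` : the vector with `α` ones followed by `r − α` zeros. -/
def oneVec (r α : ℕ) : Fin r → ℝ := fun i => if i.val < α then 1 else 0

/-- `δ_{X_•}` : the number of pairs `(a,b) ∈ X_+ × X_−` with `a < b`. -/
def deltaPol (Xplus Xminus : Finset ℕ) : ℕ :=
  ((Xplus ×ˢ Xminus).filter (fun ab => ab.1 < ab.2)).card

/-- The `i`-th coordinate (1-based) of a vector `x ∈ ℝ^q`, junk value `0` out of range. -/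
noncomputable def valAt {q : ℕ} (x : Fin q → ℝ) (i : ℕ) : ℝ :=
  if h : i - 1 < q then x ⟨i - 1, h⟩ else 0

lemma sum_fin_sort_getD (S : Finset ℕ) {r : ℕ} (h : S.card = r) :
    ∑ a : Fin r, (((S.sort (· ≤ ·)).getD a.val 0 : ℕ) : ℝ) = ∑ s ∈ S, (s : ℝ) := by
  subst h
  have key : ∀ a : Fin S.card, (S.sort (· ≤ ·)).getD a.val 0 = S.orderEmbOfFin rfl a := by
    intro a
    rw [Finset.orderEmbOfFin_apply, List.getD_eq_getElem _ _ (by simp)]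
    rfl
  simp_rw [key]
  conv_rhs => rw [← Finset.map_orderEmbOfFin_univ S rfl, Finset.sum_map]
  rfl

lemma sum_lambdaOf (m r : ℕ) (S : Finset ℕ) (h : S.card = r) :
    ∑ a : Fin r, lambdaOf m r S a
      = (r : ℝ) * m - (r : ℝ) ^ 2 + r * (r + 1) / 2 - ∑ s ∈ S, (s : ℝ) := by
  have gauss : ∑ a : Fin r, ((a.val : ℝ) + 1) = r * (r + 1) / 2 := by
    rw [Fin.sum_univ_eq_sum_range (fun i => (i : ℝ) + 1) r]
    clear h
    induction r with
    | zero => simp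
    | succ n ih => rw [Finset.sum_range_succ, ih]; push_cast; ring
  simp only [lambdaOf, Finset.sum_sub_distrib, Finset.sum_add_distrib] at gauss ⊢
  rw [sum_fin_sort_getD S h]
  simp only [Finset.sum_const, Finset.card_univ, Fintype.card_fin, nsmul_eq_mul] at gauss ⊢
  linarith

lemma card_filter_lt_sort_getD (U : Finset ℕ) {k : ℕ} (hk : k < U.card) :
    (U.filter (· < (U.sort (· ≤ ·)).getD k 0)).card = k := by
  have key : (U.sort (· ≤ ·)).getD k 0 = U.orderEmbOfFin rfl ⟨k, hk⟩ := by
    rw [Finset.orderEmbOfFin_apply, List.getD_eq_getElem _ _ (by simpa using hk)]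
    rfl
  have h : U.filter (· < U.orderEmbOfFin rfl ⟨k, hk⟩)
      = (Finset.Iio (⟨k, hk⟩ : Fin U.card)).map (U.orderEmbOfFin rfl).toEmbedding := by
    ext x
    simp only [Finset.mem_filter, Finset.mem_map, Finset.mem_Iio]
    constructor
    · rintro ⟨hx, hlt⟩
      rw [← Finset.mem_coe, ← Finset.range_orderEmbOfFin U rfl] at hx
      obtain ⟨i, rfl⟩ := hx
      exact ⟨i, (U.orderEmbOfFin rfl).lt_iff_lt.1 hlt, rfl⟩
    · rintro ⟨i, hi, rfl⟩
      exact ⟨Finset.orderEmbOfFin_mem U rfl i, (U.orderEmbOfFin rfl).lt_iff_lt.2 hi⟩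
  rw [key, h, Finset.card_map, Fin.card_Iio]

lemma sort_getD_card_filter_lt (U : Finset ℕ) {y : ℕ} (hy : y ∈ U) :
    (U.sort (· ≤ ·)).getD (U.filter (· < y)).card 0 = y := by
  obtain ⟨n, hn, rfl⟩ := List.mem_iff_getElem.1 ((Finset.mem_sort (· ≤ ·)).2 hy)
  rw [Finset.length_sort] at hn
  have h := card_filter_lt_sort_getD U hn
  rw [List.getD_eq_getElem _ _ (by simpa using hn)] at h
  rw [h, List.getD_eq_getElem]

lemma sum_filter_sort_getD_mem (U T : Finset ℕ) (hT : T ⊆ U) (f : ℕ → ℝ) :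
    ∑ i ∈ (Finset.Icc 1 U.card).filter (fun i => (U.sort (· ≤ ·)).getD (i - 1) 0 ∈ T), f i
      = ∑ y ∈ T, f ((U.filter (· < y)).card + 1) := by
  refine Finset.sum_nbij' (fun i => (U.sort (· ≤ ·)).getD (i - 1) 0)
    (fun y => (U.filter (· < y)).card + 1) ?_ ?_ ?_ ?_ ?_
  · intro i hi
    exact (Finset.mem_filter.1 hi).2
  · intro y hy
    have hlt : (U.filter (· < y)).card < U.card := by
      apply Finset.card_lt_card
      refine (Finset.filter_ssubset).2 ⟨y, hT hy, lt_irrefl y⟩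
    simp only [Finset.mem_filter, Finset.mem_Icc, Nat.add_sub_cancel]
    refine ⟨⟨by omega, by omega⟩, ?_⟩
    rw [sort_getD_card_filter_lt U (hT hy)]
    exact hy
  · intro i hi
    simp only [Finset.mem_filter, Finset.mem_Icc] at hi
    have := card_filter_lt_sort_getD U (k := i - 1) (by omega)
    simp only [this]
    omega
  · intro y hy
    simp only [Nat.add_sub_cancel]
    exact sort_getD_card_filter_lt U (hT hy)
  · intro i hi
    simp only [Finset.mem_filter, Finset.mem_Icc] at hi
    have := card_filter_lt_sort_getD U (k := i - 1) (by omega)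
    simp only [this]
    congr 1
    omega

lemma card_filter_lt_compl (m : ℕ) (S : Finset ℕ) (hS : S ⊆ Finset.Icc 1 m) {y : ℕ}
    (hy : y ∈ Finset.Icc 1 m) :
    (((Finset.Icc 1 m \ S).filter (· < y)).card : ℝ) + 1
      = y - (S.filter (· < y)).card := by
  have h := Finset.card_filter_add_card_filter_not (s := (Finset.Icc 1 m).filter (· < y)) (· ∈ S)
  have e1 : ((Finset.Icc 1 m).filter (· < y)).filter (· ∈ S) = S.filter (· < y) := by
    ext x
    have := @hS x
    simp only [Finset.mem_filter]
    tauto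
  have e2 : ((Finset.Icc 1 m).filter (· < y)).filter (fun x => ¬ x ∈ S)
      = (Finset.Icc 1 m \ S).filter (· < y) := by
    ext x
    simp only [Finset.mem_filter, Finset.mem_sdiff]
    tauto
  have e3 : (Finset.Icc 1 m).filter (· < y) = Finset.Ico 1 y := by
    ext x
    simp only [Finset.mem_filter, Finset.mem_Icc, Finset.mem_Ico] at hy ⊢
    omega
  rw [e1, e2, e3, Nat.card_Ico] at h
  rw [Finset.mem_Icc] at hy
  have h' : ((Finset.Icc 1 m \ S).filter (· < y)).card + 1 + (S.filter (· < y)).card = y := by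
    omega
  rw [eq_sub_iff_add_eq]
  exact_mod_cast h'

lemma sum_primeSet (p q r : ℕ) (S : Finset ℕ) (hS : S ⊆ Finset.Icc 1 (p + q))
    (hc : S.card = r) (hd : ∀ s ∈ S, p + q + 1 - s ∉ S) (f : ℕ → ℝ) :
    ∑ i ∈ primeSet p q r S, f i
      = ∑ s ∈ S, f (((Finset.Icc 1 (p + q) \ S).filter (· < p + q + 1 - s)).card + 1) := by
  have hU : (Finset.Icc 1 (p + q) \ S).card = p + q - r := by
    rw [Finset.card_sdiff_of_subset hS, hc, Nat.card_Icc, Nat.add_sub_cancel]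
  have hinj : Set.InjOn (fun a => p + q + 1 - a) (S : Set ℕ) := by
    intro a ha b hb hab
    have ha' := Finset.mem_Icc.1 (hS ha)
    have hb' := Finset.mem_Icc.1 (hS hb)
    simp only at hab
    omega
  have hT : S.image (fun a => p + q + 1 - a) ⊆ Finset.Icc 1 (p + q) \ S := by
    intro y hy
    obtain ⟨s, hs, rfl⟩ := Finset.mem_image.1 hy
    have hs' := Finset.mem_Icc.1 (hS hs)
    exact Finset.mem_sdiff.2 ⟨Finset.mem_Icc.2 ⟨by omega, by omega⟩, hd s hs⟩
  have h := sum_filter_sort_getD_mem _ _ hT f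
  rw [hU, Finset.sum_image hinj] at h
  exact h

lemma sum_tildeSet (p q r : ℕ) (S : Finset ℕ) (f : ℕ → ℝ) :
    ∑ k ∈ tildeSet p q r S, f k = ∑ i ∈ primeSet p q r S, f (p + q - r + 1 - i) := by
  have hP : ∀ i ∈ primeSet p q r S, 1 ≤ i ∧ i ≤ p + q - r := fun i hi =>
    Finset.mem_Icc.1 (Finset.mem_filter.1 hi).1
  have hT : ∀ i ∈ tildeSet p q r S, 1 ≤ i ∧ i ≤ p + q - r := fun i hi =>
    Finset.mem_Icc.1 (Finset.mem_filter.1 hi).1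
  have hinv : ∀ i, 1 ≤ i ∧ i ≤ p + q - r → p + q - r + 1 - (p + q - r + 1 - i) = i := by
    intro i hi
    omega
  refine Finset.sum_nbij' (fun i => p + q - r + 1 - i) (fun i => p + q - r + 1 - i)
    (fun i hi => (Finset.mem_filter.1 hi).2) ?_ (fun i hi => hinv i (hT i hi))
    (fun i hi => hinv i (hP i hi)) (fun i hi => by simp only [hinv i (hT i hi)])
  intro i hi
  have := hP i hi
  refine Finset.mem_filter.2 ⟨Finset.mem_Icc.2 ⟨by omega, by omega⟩, ?_⟩
  rwa [hinv i this]

lemma sum_polToSet (p q : ℕ) (hpq : q ≤ p) (Xplus Xminus : Finset ℕ)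
    (h1 : Xplus ⊆ Finset.Icc 1 q) (h2 : Xminus ⊆ Finset.Icc 1 q) (f : ℕ → ℝ) :
    ∑ s ∈ polToSet p q Xplus Xminus, f s
      = ∑ a ∈ Xplus, f a + ∑ b ∈ Xminus, f (p + q + 1 - b) := by
  have hinj : Set.InjOn (fun a => p + q + 1 - a) (Xminus : Set ℕ) := by
    intro a ha b hb hab
    have ha' := Finset.mem_Icc.1 (h2 ha)
    have hb' := Finset.mem_Icc.1 (h2 hb)
    simp only at hab
    omega
  rw [polToSet, Finset.sum_union, Finset.sum_image hinj]
  rw [Finset.disjoint_left]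
  intro a ha hi
  obtain ⟨b, hb, rfl⟩ := Finset.mem_image.1 hi
  have ha' := Finset.mem_Icc.1 (h1 ha)
  have hb' := Finset.mem_Icc.1 (h2 hb)
  omega

lemma polToSet_subset (p q : ℕ) (Xplus Xminus : Finset ℕ)
    (h1 : Xplus ⊆ Finset.Icc 1 q) (h2 : Xminus ⊆ Finset.Icc 1 q) :
    polToSet p q Xplus Xminus ⊆ Finset.Icc 1 (p + q) := by
  intro x hx
  rw [polToSet, Finset.mem_union, Finset.mem_image] at hx
  rw [Finset.mem_Icc]
  rcases hx with hx | ⟨b, hb, rfl⟩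
  · have := Finset.mem_Icc.1 (h1 hx)
    omega
  · have := Finset.mem_Icc.1 (h2 hb)
    omega

lemma reflect_notMem_polToSet (p q : ℕ) (hpq : q ≤ p) (Xplus Xminus : Finset ℕ)
    (h1 : Xplus ⊆ Finset.Icc 1 q) (h2 : Xminus ⊆ Finset.Icc 1 q)
    (h3 : Disjoint Xplus Xminus) (s : ℕ) (hs : s ∈ polToSet p q Xplus Xminus) :
    p + q + 1 - s ∉ polToSet p q Xplus Xminus := by
  rw [Finset.disjoint_left] at h3
  intro ht
  simp only [polToSet, Finset.mem_union, Finset.mem_image] at hs ht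
  rcases hs with hs | ⟨b, hb, rfl⟩ <;> rcases ht with ht | ⟨c, hc, hbc⟩
  · have := Finset.mem_Icc.1 (h1 hs)
    have := Finset.mem_Icc.1 (h1 ht)
    omega
  · have := Finset.mem_Icc.1 (h1 hs)
    have := Finset.mem_Icc.1 (h2 hc)
    obtain rfl : c = s := by omega
    exact h3 hs hc
  · have := Finset.mem_Icc.1 (h2 hb)
    rw [show p + q + 1 - (p + q + 1 - b) = b by omega] at ht
    exact h3 ht hb
  · have := Finset.mem_Icc.1 (h2 hb)
    have := Finset.mem_Icc.1 (h2 hc)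
    omega

lemma sum_card_filter_lt_reflect (p q : ℕ) (hpq : q ≤ p) (Xplus Xminus : Finset ℕ)
    (h1 : Xplus ⊆ Finset.Icc 1 q) (h2 : Xminus ⊆ Finset.Icc 1 q) :
    ∑ s ∈ polToSet p q Xplus Xminus,
        (((polToSet p q Xplus Xminus).filter (· < p + q + 1 - s)).card : ℝ)
      = (Xplus.card : ℝ) ^ 2 + 2 * deltaPol Xplus Xminus := by
  have hδ : (deltaPol Xplus Xminus : ℝ)
      = ∑ a ∈ Xplus, ∑ b ∈ Xminus, if a < b then (1 : ℝ) else 0 := by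
    rw [deltaPol, Finset.card_filter, Finset.sum_product]
    push_cast
    rfl
  have hc : ∀ y, (((polToSet p q Xplus Xminus).filter (· < y)).card : ℝ)
      = ∑ a ∈ Xplus, (if a < y then (1 : ℝ) else 0)
        + ∑ b ∈ Xminus, (if p + q + 1 - b < y then (1 : ℝ) else 0) := by
    intro y
    rw [Finset.card_filter]
    push_cast
    exact sum_polToSet p q hpq Xplus Xminus h1 h2 _
  simp_rw [hc]
  rw [sum_polToSet p q hpq Xplus Xminus h1 h2]
  have e1 : ∀ a ∈ Xplus, (∑ a' ∈ Xplus, (if a' < p + q + 1 - a then (1 : ℝ) else 0)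
        + ∑ b ∈ Xminus, (if p + q + 1 - b < p + q + 1 - a then (1 : ℝ) else 0))
      = Xplus.card + ∑ b ∈ Xminus, if a < b then (1 : ℝ) else 0 := by
    intro a ha
    have ha' := Finset.mem_Icc.1 (h1 ha)
    congr 1
    · rw [Finset.cast_card]
      refine Finset.sum_congr rfl fun a' h => ?_
      have := Finset.mem_Icc.1 (h1 h)
      rw [if_pos (by omega)]
    · refine Finset.sum_congr rfl fun b h => ?_
      have := Finset.mem_Icc.1 (h2 h)
      exact if_congr (by omega) rfl rfl
  have e2 : ∀ b ∈ Xminus,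
      (∑ a ∈ Xplus, (if a < p + q + 1 - (p + q + 1 - b) then (1 : ℝ) else 0)
        + ∑ b' ∈ Xminus,
          (if p + q + 1 - b' < p + q + 1 - (p + q + 1 - b) then (1 : ℝ) else 0))
      = ∑ a ∈ Xplus, if a < b then (1 : ℝ) else 0 := by
    intro b hb
    have hb' := Finset.mem_Icc.1 (h2 hb)
    rw [show p + q + 1 - (p + q + 1 - b) = b by omega, add_eq_left]
    refine Finset.sum_eq_zero fun b' h => ?_
    have := Finset.mem_Icc.1 (h2 h)
    rw [if_neg (by omega)]
  rw [Finset.sum_congr rfl e1, Finset.sum_congr rfl e2, Finset.sum_add_distrib, hδ,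
    Finset.sum_comm (s := Xminus), Finset.sum_const, nsmul_eq_mul]
  ring

/-- For a polarized subset `X_•` of `[q]` of cardinal `r ≥ 1` and any `p ≥ q`:
`|λ(X^p_•)| = |X_−| − |X_+| + (p+q+1)·♯X_+ − r(r+1)/2`,
`|λ(X̃^p_•)| = |X_−| − |X_+| + (p+q+1)·♯X_+ − r(r+1)/2 − (♯X_+)² − 2δ_{X_•}`,
and in particular `|λ(X^p_•)| − |λ(X̃^p_•)| = (♯X_+)² + 2δ_{X_•}`. -/
theorem lambda_size_formulas (p q r : ℕ) (hq : 1 ≤ q) (hpq : q ≤ p) (hr : 1 ≤ r)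
    (Xplus Xminus : Finset ℕ)
    (h1 : Xplus ⊆ Finset.Icc 1 q) (h2 : Xminus ⊆ Finset.Icc 1 q)
    (h3 : Disjoint Xplus Xminus) (h4 : Xplus.card + Xminus.card = r) :
    (∑ a : Fin r, lambdaOf (p + q) r (polToSet p q Xplus Xminus) a
      = (∑ i ∈ Xminus, (i : ℝ)) - (∑ i ∈ Xplus, (i : ℝ))
        + ((p : ℝ) + q + 1) * Xplus.card - r * (r + 1) / 2) ∧
    (∑ a : Fin r, lambdaOf (p + q - r) r (tildeSet p q r (polToSet p q Xplus Xminus)) a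
      = (∑ i ∈ Xminus, (i : ℝ)) - (∑ i ∈ Xplus, (i : ℝ))
        + ((p : ℝ) + q + 1) * Xplus.card - r * (r + 1) / 2
        - (Xplus.card : ℝ) ^ 2 - 2 * deltaPol Xplus Xminus) ∧
    ((∑ a : Fin r, lambdaOf (p + q) r (polToSet p q Xplus Xminus) a)
        - (∑ a : Fin r,
            lambdaOf (p + q - r) r (tildeSet p q r (polToSet p q Xplus Xminus)) a)
      = (Xplus.card : ℝ) ^ 2 + 2 * deltaPol Xplus Xminus) := by
  set S := polToSet p q Xplus Xminus with hSdef
  have hS : S ⊆ Finset.Icc 1 (p + q) := polToSet_subset p q Xplus Xminus h1 h2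
  have hd : ∀ s ∈ S, p + q + 1 - s ∉ S :=
    reflect_notMem_polToSet p q hpq Xplus Xminus h1 h2 h3
  have hrq : r ≤ p + q := by
    have c1 := Finset.card_le_card h1
    have c2 := Finset.card_le_card h2
    rw [Nat.card_Icc] at c1 c2
    omega
  have hrR : (Xplus.card : ℝ) + Xminus.card = r := by exact_mod_cast h4
  have hcard : S.card = r := by
    have h := sum_polToSet p q hpq Xplus Xminus h1 h2 (fun _ => 1)
    simp only [Finset.sum_const, nsmul_eq_mul, mul_one] at h
    rw [hrR] at h
    exact_mod_cast h
  have hsum : ∑ s ∈ S, (s : ℝ) = ∑ i ∈ Xplus, (i : ℝ)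
      + (((p : ℝ) + q + 1) * Xminus.card - ∑ i ∈ Xminus, (i : ℝ)) := by
    rw [hSdef, sum_polToSet p q hpq Xplus Xminus h1 h2, mul_comm, ← nsmul_eq_mul,
      ← Finset.sum_const, ← Finset.sum_sub_distrib]
    congr 1
    refine Finset.sum_congr rfl fun b hb => ?_
    have := Finset.mem_Icc.1 (h2 hb)
    rw [Nat.cast_sub (by omega)]
    push_cast
    ring
  have hprime : ∑ i ∈ primeSet p q r S, (i : ℝ) = ((p : ℝ) + q + 1) * r - ∑ s ∈ S, (s : ℝ)
      - ((Xplus.card : ℝ) ^ 2 + 2 * deltaPol Xplus Xminus) := by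
    rw [← sum_card_filter_lt_reflect p q hpq Xplus Xminus h1 h2, ← hSdef,
      sum_primeSet p q r S hS hcard hd, ← hcard, mul_comm, ← nsmul_eq_mul,
      ← Finset.sum_const, ← Finset.sum_sub_distrib, ← Finset.sum_sub_distrib]
    refine Finset.sum_congr rfl fun s hs => ?_
    have hs' := Finset.mem_Icc.1 (hS hs)
    rw [Nat.cast_add, Nat.cast_one,
      card_filter_lt_compl (p + q) S hS (Finset.mem_Icc.2 ⟨by omega, by omega⟩),
      Nat.cast_sub (by omega)]
    push_cast
    ring
  have hpcard : ((primeSet p q r S).card : ℝ) = r := by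
    rw [Finset.cast_card, sum_primeSet p q r S hS hcard hd, ← Finset.cast_card, hcard]
  have htcard : (tildeSet p q r S).card = r := by
    have h : ((tildeSet p q r S).card : ℝ) = r := by
      rw [Finset.cast_card, sum_tildeSet, ← Finset.cast_card, hpcard]
    exact_mod_cast h
  have htilde : ∑ k ∈ tildeSet p q r S, (k : ℝ)
      = ((p : ℝ) + q - r + 1) * r - ∑ i ∈ primeSet p q r S, (i : ℝ) := by
    rw [sum_tildeSet, ← hpcard, mul_comm, ← nsmul_eq_mul, ← Finset.sum_const,
      ← Finset.sum_sub_distrib, hpcard]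
    refine Finset.sum_congr rfl fun i hi => ?_
    have := Finset.mem_Icc.1 (Finset.mem_filter.1 hi).1
    rw [Nat.cast_sub (by omega), Nat.cast_add, Nat.cast_sub hrq]
    push_cast
    ring
  have hminus : (Xminus.card : ℝ) = r - Xplus.card := by linarith
  have first : ∑ a : Fin r, lambdaOf (p + q) r S a
      = (∑ i ∈ Xminus, (i : ℝ)) - (∑ i ∈ Xplus, (i : ℝ))
        + ((p : ℝ) + q + 1) * Xplus.card - r * (r + 1) / 2 := by
    rw [sum_lambdaOf (p + q) r S hcard, hsum, hminus]
    push_cast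
    ring
  have second : ∑ a : Fin r, lambdaOf (p + q - r) r (tildeSet p q r S) a
      = (∑ i ∈ Xminus, (i : ℝ)) - (∑ i ∈ Xplus, (i : ℝ))
        + ((p : ℝ) + q + 1) * Xplus.card - r * (r + 1) / 2
        - (Xplus.card : ℝ) ^ 2 - 2 * deltaPol Xplus Xminus := by
    rw [sum_lambdaOf (p + q - r) r _ htcard, htilde, hprime, hsum, hminus, Nat.cast_sub hrq]
    push_cast
    ring
  refine ⟨first, second, ?_⟩
  rw [first, second]
  ring
end
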